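/- arXiv:math/0404192 — 2 statements merged into one kernel-verified Lean document; each statement's English description precedes it below -/
import Mathlib

section
/- For every class F of real-valued functions on a set Ω, the entropy integral and the dimension integral are equivalent up to absolute constant factors: c·∫₀^∞ √(v(F,t)) dt ≤ ∫₀^∞ √(D(F,t)) dt ≤ C·∫₀^∞ √(v(F,t)) dt, where C, c > 0 are absolute constants. -/
open MeasureTheory Filter
open scoped ENNReal NNReal Pointwise BigOperators

/-- A finite subset `σ` of `Ω` is `t`-shattered by the class `F`: there is a level function `h`
such that for every partition of `σ` (given by the subset `τ = σ₊`) some `f ∈ F` lies below `h`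
on `σ₋ = σ \ τ` and above `h + t` on `σ₊ = τ`. -/
def Shatters {Ω : Type*} (F : Set (Ω → ℝ)) (t : ℝ) (σ : Finset Ω) : Prop :=
  ∃ h : Ω → ℝ, ∀ τ : Finset Ω, τ ⊆ σ →
    ∃ f ∈ F, (∀ x ∈ σ, x ∉ τ → f x ≤ h x) ∧ (∀ x ∈ τ, h x + t ≤ f x)

/-- The combinatorial dimension `v(F,t)`: the maximal cardinality of a `t`-shattered set. -/
noncomputable def combDim {Ω : Type*} (F : Set (Ω → ℝ)) (t : ℝ) : ℝ≥0∞ :=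
  ⨆ (σ : Finset Ω) (_ : Shatters F t σ), (σ.card : ℝ≥0∞)

/-- There are `m` functions in `F` that are pairwise `t`-separated in `L₂(μ)` for some
probability measure `μ` supported on a finite subset of `Ω` (given by weights `w` on `s`). -/
def KPSeparated {Ω : Type*} (F : Set (Ω → ℝ)) (t : ℝ) (m : ℕ) : Prop :=
  ∃ (s : Finset Ω) (w : Ω → ℝ) (f : Fin m → Ω → ℝ),
    (∀ x, 0 ≤ w x) ∧ (∑ x ∈ s, w x = 1) ∧ (∀ i, f i ∈ F) ∧
    ∀ i j : Fin m, i < j → t ^ 2 ≤ ∑ x ∈ s, w x * (f i x - f j x) ^ 2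

/-- The Koltchinskii–Pollard entropy `D(F,t) = log sup { m : KPSeparated F t m }`. -/
noncomputable def KPentropy {Ω : Type*} (F : Set (Ω → ℝ)) (t : ℝ) : ℝ≥0∞ :=
  ⨆ (m : ℕ) (_ : KPSeparated F t m), ENNReal.ofReal (Real.log m)


section AbstractShatter
open Classical

def PSh {ι Y : Type*} (L H : ι → Y → Prop) (A : Finset ι) (P : Finset Y) : Prop :=
  ∀ Q ⊆ P, ∃ i ∈ A, (∀ y ∈ P, y ∉ Q → L i y) ∧ ∀ y ∈ Q, H i y

lemma PSh.mono {ι Y : Type*} {L H : ι → Y → Prop} {A B : Finset ι} {P : Finset Y}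
    (h : PSh L H A P) (hAB : A ⊆ B) : PSh L H B P := by
  intro Q hQ
  obtain ⟨i, hi, h1⟩ := h Q hQ
  exact ⟨i, hAB hi, h1⟩

lemma psh_card_le_pow {ι Y : Type*} [Fintype Y] (L H : ι → Y → Prop)
    (hex : ∀ i y, L i y → H i y → False) (r : ℕ) (A : Finset ι)
    (split : ∀ B ⊆ A, 2 ≤ B.card → ∃ y, B.card ≤ 2 ^ r * (B.filter (fun i => L i y)).card ∧
      B.card ≤ 2 ^ r * (B.filter (fun i => H i y)).card) :
    ∀ m : ℕ, ∀ B ⊆ A, B.card = m → B.Nonempty →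
      B.card ≤ ((Finset.univ.filter (fun P : Finset Y => PSh L H B P)).card) ^ r := by
  intro m
  induction m using Nat.strong_induction_on with
  | _ m ih =>
  intro B hBA hm hne
  by_cases h2 : 2 ≤ B.card
  · obtain ⟨y, h1, h3⟩ := split B hBA h2
    set BL := B.filter (fun i => L i y) with hBL
    set BH := B.filter (fun i => H i y) with hBH
    have hBLs : BL ⊆ B := Finset.filter_subset _ _
    have hBHs : BH ⊆ B := Finset.filter_subset _ _
    have hL0 : 0 < BL.card := by
      rcases Nat.eq_zero_or_pos BL.card with h | h
      · rw [h] at h1; omega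
      · exact h
    have hH0 : 0 < BH.card := by
      rcases Nat.eq_zero_or_pos BH.card with h | h
      · rw [h] at h3; omega
      · exact h
    have hdisj : Disjoint BL BH := by
      rw [Finset.disjoint_left]
      intro i hi hi'
      exact hex i y (Finset.mem_filter.1 hi).2 (Finset.mem_filter.1 hi').2
    have hsum : BL.card + BH.card ≤ B.card := by
      rw [← Finset.card_union_of_disjoint hdisj]
      exact Finset.card_le_card (Finset.union_subset hBLs hBHs)
    have iL := ih BL.card (by omega) BL (hBLs.trans hBA) rfl (Finset.card_pos.1 hL0)
    have iH := ih BH.card (by omega) BH (hBHs.trans hBA) rfl (Finset.card_pos.1 hH0)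
    set SL := Finset.univ.filter (fun P : Finset Y => PSh L H BL P) with hSL
    set SH := Finset.univ.filter (fun P : Finset Y => PSh L H BH P) with hSH
    set SB := Finset.univ.filter (fun P : Finset Y => PSh L H B P) with hSB
    have hyL : ∀ P ∈ SL, y ∉ P := by
      intro P hP hy
      obtain ⟨i, hi, _, h⟩ := (Finset.mem_filter.1 hP).2 P (Finset.Subset.refl _)
      exact hex i y (Finset.mem_filter.1 hi).2 (h y hy)
    have hyH : ∀ P ∈ SH, y ∉ P := by
      intro P hP hy
      obtain ⟨i, hi, h, _⟩ := (Finset.mem_filter.1 hP).2 ∅ (Finset.empty_subset _)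
      exact hex i y (h y hy (Finset.notMem_empty _)) (Finset.mem_filter.1 hi).2
    have hins : ∀ P ∈ SL ∩ SH, insert y P ∈ SB := by
      intro P hP
      rw [Finset.mem_inter] at hP
      have hyP := hyL P hP.1
      refine Finset.mem_filter.2 ⟨Finset.mem_univ _, ?_⟩
      intro Q hQ
      by_cases hyQ : y ∈ Q
      · obtain ⟨i, hi, ha, hb⟩ := (Finset.mem_filter.1 hP.2).2 (Q.erase y) (by
          intro z hz
          rw [Finset.mem_erase] at hz
          exact (Finset.mem_insert.1 (hQ hz.2)).resolve_left hz.1)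
        refine ⟨i, hBHs hi, ?_, ?_⟩
        · intro z hz hzQ
          rcases Finset.mem_insert.1 hz with h | h
          · exact absurd (h ▸ hyQ) hzQ
          · exact ha z h (fun h' => hzQ (Finset.mem_of_mem_erase h'))
        · intro z hz
          by_cases hzy : z = y
          · rw [hzy]; exact (Finset.mem_filter.1 hi).2
          · exact hb z (Finset.mem_erase.2 ⟨hzy, hz⟩)
      · obtain ⟨i, hi, ha, hb⟩ := (Finset.mem_filter.1 hP.1).2 Q (by
          intro z hz
          exact (Finset.mem_insert.1 (hQ hz)).resolve_left (fun h => hyQ (h ▸ hz)))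
        refine ⟨i, hBLs hi, ?_, hb⟩
        intro z hz hzQ
        rcases Finset.mem_insert.1 hz with h | h
        · rw [h]; exact (Finset.mem_filter.1 hi).2
        · exact ha z h hzQ
    have hcard : SL.card + SH.card ≤ SB.card := by
      rw [← Finset.card_union_add_card_inter]
      have hinj : Set.InjOn (fun P : Finset Y => insert y P) (SL ∩ SH : Finset (Finset Y)) := by
        intro P hP P' hP' h
        have e1 := hyL P (Finset.mem_inter.1 hP).1
        have e2 := hyL P' (Finset.mem_inter.1 hP').1
        have := congrArg (fun Z : Finset Y => Z.erase y) h
        simpa [Finset.erase_insert e1, Finset.erase_insert e2] using this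
      rw [← Finset.card_image_of_injOn hinj, ← Finset.card_union_of_disjoint]
      · apply Finset.card_le_card
        intro P hP
        rcases Finset.mem_union.1 hP with h | h
        · rcases Finset.mem_union.1 h with h | h
          · exact Finset.mem_filter.2 ⟨Finset.mem_univ _, (Finset.mem_filter.1 h).2.mono hBLs⟩
          · exact Finset.mem_filter.2 ⟨Finset.mem_univ _, (Finset.mem_filter.1 h).2.mono hBHs⟩
        · obtain ⟨P', hP', rfl⟩ := Finset.mem_image.1 h
          exact hins P' hP'
      · rw [Finset.disjoint_left]
        intro P hP hP2
        obtain ⟨P', hP', rfl⟩ := Finset.mem_image.1 hP2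
        rcases Finset.mem_union.1 hP with h | h
        · exact hyL _ h (Finset.mem_insert_self _ _)
        · exact hyH _ h (Finset.mem_insert_self _ _)
    rcases le_total SL.card SH.card with h | h
    · calc B.card ≤ 2 ^ r * SL.card ^ r := h1.trans (Nat.mul_le_mul_left _ iL)
        _ = (2 * SL.card) ^ r := (mul_pow _ _ _).symm
        _ ≤ SB.card ^ r := Nat.pow_le_pow_left (by omega) _
    · calc B.card ≤ 2 ^ r * SH.card ^ r := h3.trans (Nat.mul_le_mul_left _ iH)
        _ = (2 * SH.card) ^ r := (mul_pow _ _ _).symm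
        _ ≤ SB.card ^ r := Nat.pow_le_pow_left (by omega) _
  · have : 0 < (Finset.univ.filter (fun P : Finset Y => PSh L H B P)).card := by
      refine Finset.card_pos.2 ⟨∅, Finset.mem_filter.2 ⟨Finset.mem_univ _, ?_⟩⟩
      intro Q hQ
      obtain ⟨i, hi⟩ := hne
      refine ⟨i, hi, by simp, ?_⟩
      intro y hy
      exact absurd (hQ hy) (Finset.notMem_empty _)
    calc B.card ≤ 1 := by omega
      _ ≤ _ := Nat.one_le_pow _ _ this

lemma sample_exists {κ Y : Type*} (E : Finset κ) (sep : κ → Y → Prop) (S : Finset Y)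
    (w : Y → ℝ) (hw : ∀ y, 0 ≤ w y) (hw1 : ∑ y ∈ S, w y = 1) (η : ℝ)
    (hη : ∀ e ∈ E, η ≤ ∑ y ∈ S, if sep e y then w y else 0) (n : ℕ) :
    ∃ y : Fin n → Y, ∀ e ∈ E,
      Real.exp (-((Finset.univ.filter (fun k => sep e (y k))).card : ℝ)) ≤
        E.card * Real.exp (-(η / 2 * n)) := by
  set g : κ → Y → ℝ := fun e y => if sep e y then Real.exp (-1) else 1 with hg
  have hgpos : ∀ e y, 0 < g e y := by
    intro e y; simp only [hg]; split_ifs <;> positivity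
  have hexp : ∀ e (y : Fin n → Y), Real.exp (-((Finset.univ.filter (fun k => sep e (y k))).card : ℝ))
      = ∏ k, g e (y k) := by
    intro e y
    simp only [hg]
    rw [Finset.prod_ite]
    simp [← Real.exp_nat_mul]
  have he1 : Real.exp (-1) ≤ 1 / 2 := by
    rw [Real.exp_neg, one_div]
    apply inv_anti₀ (by norm_num)
    linarith [Real.add_one_le_exp 1]
  have hone : ∀ e ∈ E, ∑ y ∈ S, w y * g e y ≤ Real.exp (-(η / 2)) := by
    intro e he
    have h1 : ∀ y ∈ S, w y * g e y ≤ w y - (1 / 2) * (if sep e y then w y else 0) := by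
      intro y _
      simp only [hg]
      split_ifs
      · nlinarith [hw y]
      · simp
    have h2 := Finset.sum_le_sum h1
    rw [Finset.sum_sub_distrib, hw1, ← Finset.mul_sum] at h2
    have := hη e he
    have h3 := Real.add_one_le_exp (-(η / 2))
    linarith
  set W : (Fin n → Y) → ℝ := fun y => ∏ k, w (y k) with hW
  have hW0 : ∀ y, 0 ≤ W y := fun y => Finset.prod_nonneg (fun k _ => hw _)
  have hW1 : ∑ y ∈ Fintype.piFinset (fun _ : Fin n => S), W y = 1 := by
    simp only [hW]
    rw [← Finset.prod_univ_sum (fun _ : Fin n => S) (fun _ y => w y)]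
    simp [hw1]
  set b : ℝ := E.card * Real.exp (-(η / 2 * n)) with hb
  have htot : ∑ y ∈ Fintype.piFinset (fun _ : Fin n => S), W y * (∑ e ∈ E, ∏ k, g e (y k)) ≤ b := by
    simp only [Finset.mul_sum]
    rw [Finset.sum_comm]
    have : ∀ e ∈ E, ∑ y ∈ Fintype.piFinset (fun _ : Fin n => S), W y * ∏ k, g e (y k)
        ≤ Real.exp (-(η / 2 * n)) := by
      intro e he
      simp only [hW, ← Finset.prod_mul_distrib]
      rw [← Finset.prod_univ_sum (fun _ : Fin n => S) (fun _ y => w y * g e y)]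
      simp only [Finset.prod_const, Finset.card_univ, Fintype.card_fin]
      calc _ ≤ (Real.exp (-(η / 2))) ^ n := by
            apply pow_le_pow_left₀ _ (hone e he)
            exact Finset.sum_nonneg (fun y _ => mul_nonneg (hw y) (hgpos e y).le)
        _ = _ := by rw [← Real.exp_nat_mul]; congr 1; ring
    calc _ ≤ ∑ e ∈ E, Real.exp (-(η / 2 * n)) := Finset.sum_le_sum this
      _ = b := by simp [hb]
  have hex : ∃ y : Fin n → Y, ∑ e ∈ E, ∏ k, g e (y k) ≤ b := by
    by_contra hcon
    push Not at hcon
    have h0 : ∑ y ∈ Fintype.piFinset (fun _ : Fin n => S),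
        W y * ((∑ e ∈ E, ∏ k, g e (y k)) - b) ≤ 0 := by
      simp only [mul_sub]
      rw [Finset.sum_sub_distrib, ← Finset.sum_mul, hW1]
      linarith
    have hnn : ∀ y ∈ Fintype.piFinset (fun _ : Fin n => S),
        0 ≤ W y * ((∑ e ∈ E, ∏ k, g e (y k)) - b) :=
      fun y _ => mul_nonneg (hW0 y) (by linarith [hcon y])
    have h00 := (Finset.sum_eq_zero_iff_of_nonneg hnn).1 (le_antisymm h0 (Finset.sum_nonneg hnn))
    have : ∑ y ∈ Fintype.piFinset (fun _ : Fin n => S), W y = 0 := by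
      apply Finset.sum_eq_zero
      intro y hy
      rcases mul_eq_zero.1 (h00 y hy) with h | h
      · exact h
      · linarith [hcon y]
    linarith
  obtain ⟨y, hy⟩ := hex
  refine ⟨y, fun e he => ?_⟩
  rw [hexp]
  exact (Finset.single_le_sum (f := fun e => ∏ k, g e (y k))
    (fun e _ => Finset.prod_nonneg (fun k _ => (hgpos e _).le)) he).trans hy

/-- Number of small subsets. -/
lemma card_small_subsets (n V : ℕ) (hV : 0 < V) (hVn : V ≤ n) :
    ((Finset.univ.filter (fun P : Finset (Fin n) => P.card ≤ V)).card : ℝ) ≤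
      Real.exp (V * (1 + Real.log (n / V))) := by
  have hVr : (0:ℝ) < V := by exact_mod_cast hV
  have hnr : (0:ℝ) < n := by exact_mod_cast lt_of_lt_of_le hV hVn
  set x : ℝ := V / n with hx
  have hx0 : 0 < x := by positivity
  have hx1 : x ≤ 1 := by rw [hx, div_le_one hnr]; exact_mod_cast hVn
  have h1 : ∑ P : Finset (Fin n), x ^ P.card = (x + 1) ^ n := by
    have := Finset.sum_pow_mul_eq_add_pow x 1 (Finset.univ : Finset (Fin n))
    simpa using this
  have h2 : ((Finset.univ.filter (fun P : Finset (Fin n) => P.card ≤ V)).card : ℝ) * x ^ V ≤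
      (x + 1) ^ n := by
    rw [← h1]
    calc _ = ∑ P ∈ Finset.univ.filter (fun P : Finset (Fin n) => P.card ≤ V), x ^ V := by simp
      _ ≤ ∑ P ∈ Finset.univ.filter (fun P : Finset (Fin n) => P.card ≤ V), x ^ P.card := by
          apply Finset.sum_le_sum
          intro P hP
          exact pow_le_pow_of_le_one hx0.le hx1 (Finset.mem_filter.1 hP).2
      _ ≤ _ := Finset.sum_le_univ_sum_of_nonneg (fun P => by positivity)
  have h3 : (x + 1) ^ n ≤ Real.exp V := by
    calc (x + 1) ^ n ≤ (Real.exp x) ^ n :=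
          pow_le_pow_left₀ (by positivity) (Real.add_one_le_exp x) _
      _ = Real.exp V := by rw [← Real.exp_nat_mul]; congr 1; rw [hx]; field_simp
  have h4 : x ^ V = Real.exp (-(V * Real.log (n / V))) := by
    rw [← Real.exp_log hx0, ← Real.exp_nat_mul, hx]
    congr 1
    rw [Real.log_div hVr.ne' hnr.ne', Real.log_div hnr.ne' hVr.ne']
    ring
  have h5 := h2.trans h3
  rw [h4, Real.exp_neg, mul_inv_le_iff₀ (Real.exp_pos _), ← Real.exp_add] at h5
  rw [show (V : ℝ) * (1 + Real.log (n / V)) = V + V * Real.log (n / V) by ring]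
  exact h5

end AbstractShatter

section AbstractMain
open Classical

lemma solve_log_ineq (X a b : ℝ) (hX : 0 < X) (ha : 0 < a) (hb : 0 < b)
    (h : X ≤ a * Real.log (b * X)) : X ≤ 2 * a * Real.log (2 * a * b) := by
  have h1 : Real.log (b * X) = Real.log (X / (2 * a)) + Real.log (2 * a * b) := by
    rw [← Real.log_mul (by positivity) (by positivity)]
    congr 1
    field_simp
  have h2 : Real.log (X / (2 * a)) ≤ X / (2 * a) := Real.log_le_self (by positivity)
  have h3 : a * (X / (2 * a)) = X / 2 := by field_simp
  have h4 : a * Real.log (b * X) ≤ X / 2 + a * Real.log (2 * a * b) := by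
    rw [h1, mul_add, ← h3]
    gcongr
  linarith

def PSep {ι Y : Type*} (L H : ι → Y → Prop) (i j : ι) (y : Y) : Prop :=
  (L i y ∧ H j y) ∨ (L j y ∧ H i y)

lemma split_exists {ι Y : Type*} (L H : ι → Y → Prop) (A : Finset ι) (q n : ℕ)
    (y : Fin n → Y) (hn : 0 < n)
    (hy : ∀ i ∈ A, ∀ j ∈ A, i ≠ j → (1 / 2 : ℝ) ^ q / 4 * n ≤
      ((Finset.univ.filter (fun k => PSep L H i j (y k))).card : ℝ))
    (B : Finset ι) (hB : B ⊆ A) (hB2 : 2 ≤ B.card) :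
    ∃ k, B.card ≤ 2 ^ (q + 4) * (B.filter (fun i => L i (y k))).card ∧
      B.card ≤ 2 ^ (q + 4) * (B.filter (fun i => H i (y k))).card := by
  set η : ℝ := (1 / 2 : ℝ) ^ q with hη
  have hη0 : 0 < η := by positivity
  set l : Fin n → ℝ := fun k => ((B.filter (fun i => L i (y k))).card : ℝ) with hl
  set h : Fin n → ℝ := fun k => ((B.filter (fun i => H i (y k))).card : ℝ) with hh
  have key : ∀ k, l k * h k = ∑ i ∈ B, ∑ j ∈ B, if L i (y k) ∧ H j (y k) then (1:ℝ) else 0 := by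
    intro k
    simp only [hl, hh, Finset.card_filter, Nat.cast_sum, Finset.sum_mul_sum]
    refine Finset.sum_congr rfl fun i _ => Finset.sum_congr rfl fun j _ => ?_
    by_cases h1 : L i (y k) <;> by_cases h2 : H j (y k) <;> simp [h1, h2]
  have key2 : ∀ k, l k * h k = ∑ i ∈ B, ∑ j ∈ B, if L j (y k) ∧ H i (y k) then (1:ℝ) else 0 := by
    intro k
    rw [key, Finset.sum_comm]
  have hsum : ((B.card : ℝ) * (B.card - 1)) * (η / 4 * n) ≤ ∑ k, 2 * (l k * h k) := by
    have e1 : ∑ k, 2 * (l k * h k) = ∑ i ∈ B, ∑ j ∈ B, ∑ k,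
        ((if L i (y k) ∧ H j (y k) then (1:ℝ) else 0) +
          (if L j (y k) ∧ H i (y k) then (1:ℝ) else 0)) := by
      calc _ = ∑ k, ∑ i ∈ B, ∑ j ∈ B, ((if L i (y k) ∧ H j (y k) then (1:ℝ) else 0) +
          (if L j (y k) ∧ H i (y k) then (1:ℝ) else 0)) := by
            refine Finset.sum_congr rfl fun k _ => ?_
            simp only [Finset.sum_add_distrib]
            rw [← key, ← key2]; ring
        _ = _ := by
            rw [Finset.sum_comm]
            refine Finset.sum_congr rfl fun i _ => ?_
            rw [Finset.sum_comm]
    rw [e1]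
    have e2 : ∀ i ∈ B, ∀ j ∈ B, (if i = j then 0 else η / 4 * n) ≤ ∑ k,
        ((if L i (y k) ∧ H j (y k) then (1:ℝ) else 0) +
          (if L j (y k) ∧ H i (y k) then (1:ℝ) else 0)) := by
      intro i hi j hj
      split_ifs with hij
      · apply Finset.sum_nonneg
        intro k _
        split_ifs <;> norm_num
      · refine (hy i (hB hi) j (hB hj) hij).trans ?_
        rw [Finset.card_filter, Nat.cast_sum]
        refine Finset.sum_le_sum fun k _ => ?_
        by_cases h1 : L i (y k) ∧ H j (y k) <;> by_cases h2 : L j (y k) ∧ H i (y k) <;>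
          simp [PSep, h1, h2]
    refine le_trans (le_of_eq ?_) (Finset.sum_le_sum fun i hi => Finset.sum_le_sum (e2 i hi))
    have e3 : ∀ i ∈ B, ∑ j ∈ B, (if i = j then 0 else η / 4 * n) = (B.card - 1 : ℝ) * (η / 4 * n) := by
      intro i hi
      have : ∀ j ∈ B, (if i = j then 0 else η / 4 * (n:ℝ)) = η / 4 * n - (if i = j then η / 4 * (n:ℝ) else 0) := by
        intro j _; split_ifs <;> simp
      rw [Finset.sum_congr rfl this, Finset.sum_sub_distrib, Finset.sum_ite_eq]
      simp [hi]; ring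
    rw [Finset.sum_congr rfl e3]
    simp; ring
  have hb2 : (2:ℝ) ≤ B.card := by exact_mod_cast hB2
  have hnr : (0:ℝ) < n := by exact_mod_cast hn
  have hex : ∃ k, (B.card : ℝ) ^ 2 * η / 16 ≤ l k * h k := by
    by_contra hcon
    push Not at hcon
    have : ∑ k, 2 * (l k * h k) < ∑ k : Fin n, 2 * ((B.card : ℝ) ^ 2 * η / 16) := by
      apply Finset.sum_lt_sum_of_nonempty
      · exact ⟨⟨0, hn⟩, Finset.mem_univ _⟩
      · intro k _
        linarith [hcon k]
    simp only [Finset.sum_const, Finset.card_univ, Fintype.card_fin, nsmul_eq_mul] at this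
    have h3 : (B.card : ℝ) ^ 2 / 2 ≤ (B.card : ℝ) * (B.card - 1) := by nlinarith
    have h4 : (B.card : ℝ) ^ 2 / 2 * (η / 4 * n) ≤ (B.card : ℝ) * (B.card - 1) * (η / 4 * n) := by
      gcongr
    nlinarith
  obtain ⟨k, hk⟩ := hex
  have hlB : l k ≤ B.card := by
    simp only [hl]; exact_mod_cast Finset.card_le_card (Finset.filter_subset _ _)
  have hhB : h k ≤ B.card := by
    simp only [hh]; exact_mod_cast Finset.card_le_card (Finset.filter_subset _ _)
  have hl0 : 0 ≤ l k := by simp [hl]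
  have hh0 : 0 ≤ h k := by simp [hh]
  have hη2 : (2:ℝ) ^ (q + 4) * (η / 16) = 1 := by
    rw [hη, pow_add, one_div, inv_pow]
    field_simp
    norm_num
  have h2p : (0:ℝ) < 2 ^ (q + 4) := by positivity
  have hk2 : (B.card : ℝ) ^ 2 ≤ 2 ^ (q + 4) * (l k * h k) := by
    calc (B.card : ℝ) ^ 2 = 2 ^ (q + 4) * ((B.card : ℝ) ^ 2 * η / 16) := by
          rw [show (2:ℝ) ^ (q + 4) * ((B.card : ℝ) ^ 2 * η / 16) =
            (B.card : ℝ) ^ 2 * ((2:ℝ) ^ (q + 4) * (η / 16)) by ring, hη2, mul_one]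
      _ ≤ _ := by gcongr
  have hb0 : (0:ℝ) < B.card := by linarith
  refine ⟨k, ?_, ?_⟩
  · have : (B.card : ℝ) ≤ 2 ^ (q + 4) * l k := by
      have : (B.card : ℝ) * B.card ≤ (2 ^ (q + 4) * l k) * B.card := by
        calc (B.card : ℝ) * B.card = (B.card : ℝ) ^ 2 := by ring
          _ ≤ 2 ^ (q + 4) * (l k * h k) := hk2
          _ ≤ 2 ^ (q + 4) * (l k * B.card) := by gcongr
          _ = _ := by ring
      exact le_of_mul_le_mul_right this hb0
    simp only [hl] at this
    exact_mod_cast this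
  · have : (B.card : ℝ) ≤ 2 ^ (q + 4) * h k := by
      have : (B.card : ℝ) * B.card ≤ (2 ^ (q + 4) * h k) * B.card := by
        calc (B.card : ℝ) * B.card = (B.card : ℝ) ^ 2 := by ring
          _ ≤ 2 ^ (q + 4) * (l k * h k) := hk2
          _ ≤ 2 ^ (q + 4) * (B.card * h k) := by gcongr
          _ = _ := by ring
      exact le_of_mul_le_mul_right this hb0
    simp only [hh] at this
    exact_mod_cast this

lemma psh_push {ι Y : Type*} (L H : ι → Y → Prop) (hex : ∀ i y, L i y → H i y → False)
    (A : Finset ι) (n : ℕ) (y : Fin n → Y) (P : Finset (Fin n))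
    (hP : PSh (fun i k => L i (y k)) (fun i k => H i (y k)) A P) :
    PSh L H A (P.image y) ∧ (P.image y).card = P.card := by
  constructor
  · intro Q hQ
    obtain ⟨i, hi, h1, h2⟩ := hP (P.filter (fun k => y k ∈ Q)) (Finset.filter_subset _ _)
    refine ⟨i, hi, ?_, ?_⟩
    · intro z hz hzQ
      obtain ⟨k, hk, rfl⟩ := Finset.mem_image.1 hz
      exact h1 k hk (fun h => hzQ (Finset.mem_filter.1 h).2)
    · intro z hz
      obtain ⟨k, hk, rfl⟩ := Finset.mem_image.1 (hQ hz)
      exact h2 k (Finset.mem_filter.2 ⟨hk, hz⟩)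
  · apply Finset.card_image_of_injOn
    intro k hk k' hk' h
    by_contra hne
    obtain ⟨i, hi, h1, h2⟩ := hP {k} (by simpa using hk)
    have a1 := h1 k' hk' (by simpa using fun h => hne h.symm)
    have a2 := h2 k (by simp)
    simp only [h] at a2
    exact hex i _ a1 a2

theorem abs_main {ι Y : Type*} (L H : ι → Y → Prop) (hex : ∀ i y, L i y → H i y → False)
    (S : Finset Y) (w : Y → ℝ) (hw : ∀ y, 0 ≤ w y) (hw1 : ∑ y ∈ S, w y = 1)
    (A : Finset ι) (q V : ℕ)
    (hsep : ∀ i ∈ A, ∀ j ∈ A, i ≠ j → (1 / 2 : ℝ) ^ q ≤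
      ∑ y ∈ S, if PSep L H i j y then w y else 0)
    (hV : ∀ P : Finset Y, PSh L H A P → P.card ≤ V) :
    Real.log A.card ≤ 4 * ((q : ℝ) + 5) ^ 2 * V := by
  by_cases hA : A.card ≤ 1
  · have : Real.log A.card ≤ 0 := Real.log_nonpos (by positivity) (by exact_mod_cast hA)
    exact this.trans (by positivity)
  have hA2 : 2 ≤ A.card := by omega
  have hA2r : (2:ℝ) ≤ A.card := by exact_mod_cast hA2
  set η : ℝ := (1 / 2 : ℝ) ^ q with hη
  have hη0 : 0 < η := by positivity
  have hη1 : η ≤ 1 := pow_le_one₀ (by norm_num) (by norm_num)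
  set lN : ℝ := Real.log A.card with hlN
  have hlN2 : 1 / 2 ≤ lN := by
    have h1 := Real.log_le_log (by norm_num) hA2r
    linarith [Real.log_two_gt_d9]
  set n : ℕ := ⌈8 * lN / η⌉₊ with hn
  have hn1 : 8 * lN / η ≤ n := Nat.le_ceil _
  have hn1' : 8 * lN ≤ n * η := by rwa [div_le_iff₀ hη0] at hn1
  have hn2 : (n:ℝ) ≤ 10 * lN / η := by
    have h1 : (n:ℝ) < 8 * lN / η + 1 := Nat.ceil_lt_add_one (by positivity)
    have h2 : 1 ≤ 2 * lN / η := by rw [le_div_iff₀ hη0]; linarith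
    have h3 : 10 * lN / η = 8 * lN / η + 2 * lN / η := by ring
    linarith
  have hnpos : 0 < n := by
    have : (0:ℝ) < n := lt_of_lt_of_le (by positivity) hn1
    exact_mod_cast this
  obtain ⟨y, hy⟩ := sample_exists A.offDiag
    (fun e y => PSep L H e.1 e.2 y) S w hw hw1 η
    (by
      rintro ⟨i, j⟩ he
      rw [Finset.mem_offDiag] at he
      exact hsep i he.1 j he.2.1 he.2.2) n
  have hcardE : ((A.offDiag.card : ℕ) : ℝ) ≤ Real.exp (2 * lN) := by
    have h1 : A.offDiag.card ≤ A.card * A.card := by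
      rw [Finset.offDiag_card]; omega
    have h2 : Real.exp (2 * lN) = (A.card : ℝ) * A.card := by
      rw [two_mul, Real.exp_add, hlN, Real.exp_log (by linarith)]
    rw [h2]; exact_mod_cast h1
  have hy' : ∀ i ∈ A, ∀ j ∈ A, i ≠ j → (1 / 2 : ℝ) ^ q / 4 * n ≤
      ((Finset.univ.filter (fun k => PSep L H i j (y k))).card : ℝ) := by
    intro i hi j hj hij
    have h1 := hy (i, j) (Finset.mem_offDiag.2 ⟨hi, hj, hij⟩)
    have h2 := h1.trans (mul_le_mul_of_nonneg_right hcardE (Real.exp_pos _).le)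
    rw [← Real.exp_add, Real.exp_le_exp] at h2
    simp only [] at h2
    have : η / 4 * n ≤ η / 2 * n - 2 * lN := by linarith
    linarith
  have hcount := psh_card_le_pow (fun i k => L i (y k)) (fun i k => H i (y k))
    (fun i k => hex i (y k)) (q + 4) A
    (fun B hB hB2 => split_exists L H A q n y hnpos hy' B hB hB2) A.card A (Finset.Subset.refl _) rfl
    (Finset.card_pos.1 (by omega))
  have hsub : (Finset.univ.filter (fun P : Finset (Fin n) =>
      PSh (fun i k => L i (y k)) (fun i k => H i (y k)) A P)).card ≤
      (Finset.univ.filter (fun P : Finset (Fin n) => P.card ≤ V)).card := by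
    apply Finset.card_le_card
    intro P hP
    obtain ⟨h1, h2⟩ := psh_push L H hex A n y P (Finset.mem_filter.1 hP).2
    exact Finset.mem_filter.2 ⟨Finset.mem_univ _, h2 ▸ hV _ h1⟩
  have hcount2 := hcount.trans (Nat.pow_le_pow_left hsub _)
  rcases Nat.eq_zero_or_pos V with hV0 | hVpos
  · exfalso
    have : (Finset.univ.filter (fun P : Finset (Fin n) => P.card ≤ V)).card ≤ 1 := by
      rw [Finset.card_le_one]
      intro a ha b hb
      have h1 := (Finset.mem_filter.1 ha).2
      have h2 := (Finset.mem_filter.1 hb).2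
      rw [hV0, Nat.le_zero, Finset.card_eq_zero] at h1 h2
      rw [h1, h2]
    have := hcount2.trans (Nat.pow_le_pow_left this _)
    simp at this
    omega
  have hVr : (1:ℝ) ≤ V := by exact_mod_cast hVpos
  have hq0 : (0:ℝ) ≤ q := by positivity
  by_cases hcase : lN ≤ V
  · refine hcase.trans ?_
    have : 1 ≤ 4 * ((q:ℝ) + 5) ^ 2 := by nlinarith
    nlinarith
  push Not at hcase
  have hVn : V ≤ n := by
    have : (V:ℝ) ≤ n := by
      have : (n:ℝ) * η ≤ n := mul_le_of_le_one_right (by positivity) hη1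
      linarith
    exact_mod_cast this
  have hc3 := card_small_subsets n V hVpos hVn
  have hc4 : (A.card : ℝ) ≤ (Real.exp (V * (1 + Real.log (n / V)))) ^ (q + 4) := by
    calc (A.card : ℝ) ≤ ((Finset.univ.filter (fun P : Finset (Fin n) => P.card ≤ V)).card : ℝ) ^ (q + 4) := by
          exact_mod_cast hcount2
      _ ≤ _ := pow_le_pow_left₀ (by positivity) hc3 _
  rw [← Real.exp_nat_mul] at hc4
  have hc5 : lN ≤ ((q + 4 : ℕ) : ℝ) * (V * (1 + Real.log (n / V))) := by
    have := Real.log_le_log (by linarith) hc4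
    rwa [Real.log_exp] at this
  push_cast at hc5
  have hVp : (0:ℝ) < V := by linarith
  have hX : lN / V ≤ (q + 4 : ℝ) * Real.log (28 / η * (lN / V)) := by
    rw [div_le_iff₀ hVp]
    have hnr : (0:ℝ) < n := by exact_mod_cast hnpos
    have h1 : 1 + Real.log (n / V) ≤ Real.log (28 / η * (lN / V)) := by
      have : (1:ℝ) = Real.log (Real.exp 1) := by simp
      rw [this, ← Real.log_mul (by positivity) (by positivity)]
      apply Real.log_le_log (by positivity)
      have he : Real.exp 1 ≤ 2.8 := by linarith [Real.exp_one_lt_d9]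
      calc Real.exp 1 * (n / V) ≤ 2.8 * ((10 * lN / η) / V) := by gcongr
        _ = _ := by field_simp; norm_num
    calc lN ≤ _ := hc5
      _ ≤ (q + 4 : ℝ) * (V * Real.log (28 / η * (lN / V))) := by gcongr
      _ = _ := by ring
  have hfin := solve_log_ineq (lN / V) (q + 4) (28 / η) (by positivity) (by positivity) (by positivity) hX
  have hlog : Real.log (2 * (q + 4 : ℝ) * (28 / η)) ≤ 2 * q + 10 := by
    have h1 : 2 * (q + 4 : ℝ) * (28 / η) ≤ 2 ^ (2 * q + 10) := by
      have hinv : 1 / η = 2 ^ q := by rw [hη, one_div, one_div, inv_pow, inv_inv]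
      have hq4 : (q + 4 : ℝ) ≤ 2 ^ (q + 4) := by
        have : q + 4 < 2 ^ (q + 4) := Nat.lt_two_pow_self
        exact_mod_cast this.le
      calc 2 * (q + 4 : ℝ) * (28 / η) = 56 * (q + 4 : ℝ) * (1 / η) := by ring
        _ ≤ 64 * 2 ^ (q + 4) * 2 ^ q := by rw [hinv]; gcongr; norm_num
        _ = _ := by rw [show 2 * q + 10 = q + 4 + q + 6 by ring, pow_add, pow_add]; ring
    have h2 := Real.log_le_log (by positivity) h1
    rw [Real.log_pow] at h2
    push_cast at h2
    have := Real.log_two_lt_d9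
    nlinarith
  rw [div_le_iff₀ hVp] at hfin
  refine hfin.trans (mul_le_mul_of_nonneg_right ?_ hVp.le)
  calc 2 * (q + 4 : ℝ) * Real.log (2 * (q + 4 : ℝ) * (28 / η)) ≤ 2 * (q + 4 : ℝ) * (2 * q + 10) := by gcongr
    _ ≤ 4 * ((q : ℝ) + 5) ^ 2 := by nlinarith

end AbstractMain

section LevelBound
open Classical

lemma psh_shatters {ι Ω : Type*} (F : Set (Ω → ℝ)) (f : ι → Ω → ℝ) (I : Finset ι)
    (hf : ∀ i ∈ I, f i ∈ F) (v : ℝ) (hv : 0 < v) (lev : Ω → ℕ → ℝ)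
    (hlev : ∀ x, ∀ a b : ℕ, a < b → lev x a ≤ lev x b) (P : Finset (Ω × ℕ))
    (hP : PSh (fun i (y : Ω × ℕ) => f i y.1 ≤ lev y.1 y.2)
      (fun i (y : Ω × ℕ) => lev y.1 y.2 + v ≤ f i y.1) I P) :
    Shatters F v (P.image Prod.fst) ∧ (P.image Prod.fst).card = P.card := by
  have hinj : ∀ x a b, (x, a) ∈ P → (x, b) ∈ P → a = b := by
    have aux : ∀ x a b, (x, a) ∈ P → (x, b) ∈ P → ¬ a < b := by
      intro x a b ha hb hab
      obtain ⟨i, hi, h1, h2⟩ := hP {(x, b)} (by simpa using hb)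
      have e1 := h1 (x, a) ha (by simp; omega)
      have e2 := h2 (x, b) (by simp)
      have := hlev x a b hab
      simp only at e1 e2
      linarith
    intro x a b ha hb
    have := aux x a b ha hb
    have := aux x b a hb ha
    omega
  constructor
  · refine ⟨fun x => if h : ∃ a, (x, a) ∈ P then lev x h.choose else 0, ?_⟩
    have hh : ∀ x a, (x, a) ∈ P →
        (if h : ∃ a, (x, a) ∈ P then lev x h.choose else 0) = lev x a := by
      intro x a ha
      have hex : ∃ a, (x, a) ∈ P := ⟨a, ha⟩
      rw [dif_pos hex, hinj x _ _ hex.choose_spec ha]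
    intro τ hτ
    obtain ⟨i, hi, h1, h2⟩ := hP (P.filter (fun y => y.1 ∈ τ)) (Finset.filter_subset _ _)
    refine ⟨f i, hf i hi, ?_, ?_⟩
    · intro x hx hxτ
      obtain ⟨⟨x', a⟩, hy, rfl⟩ := Finset.mem_image.1 hx
      simp only at hxτ ⊢
      rw [hh x' a hy]
      exact h1 (x', a) hy (fun h => hxτ (Finset.mem_filter.1 h).2)
    · intro x hx
      obtain ⟨⟨x', a⟩, hy, rfl⟩ := Finset.mem_image.1 (hτ hx)
      simp only at hx ⊢
      rw [hh x' a hy]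
      exact h2 (x', a) (Finset.mem_filter.2 ⟨hy, hx⟩)
  · apply Finset.card_image_of_injOn
    rintro ⟨x, a⟩ hy ⟨x', b⟩ hy' h
    simp only at h
    subst h
    rw [hinj x a b hy hy']

lemma exists_level (fi fj g A v : ℝ) (p : ℕ) (hv : 0 < v) (hp : 2 * A ≤ p * v)
    (h1 : fi + 2 * v ≤ fj) (h2 : |fi - g| ≤ A) (h3 : |fj - g| ≤ A) :
    ∃ a ∈ Finset.range p, fi ≤ g - A + a * v ∧ g - A + a * v + v ≤ fj := by
  rw [abs_le] at h2 h3
  set z := (fi - g + A) / v with hz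
  have hz0 : 0 ≤ z := div_nonneg (by linarith) hv.le
  have hzv : z * v = fi - g + A := by rw [hz]; field_simp
  have c1 : z ≤ ⌈z⌉₊ := Nat.le_ceil z
  have c2 : (⌈z⌉₊ : ℝ) < z + 1 := Nat.ceil_lt_add_one hz0
  have c3 : z * v ≤ ⌈z⌉₊ * v := by gcongr
  have c4 : (⌈z⌉₊ : ℝ) * v < (z + 1) * v := by gcongr
  refine ⟨⌈z⌉₊, ?_, by linarith, by linarith⟩
  rw [Finset.mem_range]
  have : (⌈z⌉₊ : ℝ) * v < p * v := by linarith
  have := lt_of_mul_lt_mul_right this hv.le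
  exact_mod_cast this

lemma level_bound {ι Ω : Type*} (F : Set (Ω → ℝ)) (s : Finset Ω) (w : Ω → ℝ)
    (hw : ∀ x, 0 ≤ w x) (hw1 : ∑ x ∈ s, w x = 1) (f : ι → Ω → ℝ) (I : Finset ι)
    (hf : ∀ i ∈ I, f i ∈ F) (g : Ω → ℝ) (r : ℝ) (hr : 0 < r) (k : ℕ)
    (hloc : ∀ i ∈ I, ∑ x ∈ s, w x * (f i x - g x) ^ 2 ≤ 4 * r ^ 2)
    (hsep : ∀ i ∈ I, ∀ j ∈ I, i ≠ j → (1 / 8 : ℝ) ^ (k + 1) ≤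
      ∑ x ∈ s, if 2 ^ k * r / 4 ≤ |f i x - f j x| then w x else 0) :
    ENNReal.ofReal (Real.log I.card) ≤
      ENNReal.ofReal (4 * (4 * (k : ℝ) + 17) ^ 2) * combDim F (2 ^ k * r / 8) := by
  by_cases htop : combDim F (2 ^ k * r / 8) = ⊤
  · rw [htop, ENNReal.mul_top]
    · exact le_top
    · simp only [ne_eq, ENNReal.ofReal_eq_zero, not_le]; positivity
  set V : ℕ := ⌊(combDim F (2 ^ k * r / 8)).toReal⌋₊ with hVdef
  have hVle : ENNReal.ofReal V ≤ combDim F (2 ^ k * r / 8) :=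
    ENNReal.ofReal_le_of_le_toReal (Nat.floor_le ENNReal.toReal_nonneg)
  have hVsh : ∀ σ, Shatters F (2 ^ k * r / 8) σ → σ.card ≤ V := by
    intro σ hσ
    apply Nat.le_floor
    have h1 : (σ.card : ℝ≥0∞) ≤ combDim F (2 ^ k * r / 8) :=
      le_iSup₂_of_le σ hσ le_rfl
    have := (ENNReal.toReal_le_toReal (by simp) htop).2 h1
    simpa using this
  set v : ℝ := 2 ^ k * r / 8 with hvdef
  have hv : 0 < v := by positivity
  set A : ℝ := 16 * 4 ^ k * r with hAdef
  have hA : 0 < A := by positivity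
  set p : ℕ := 256 * 2 ^ k with hpdef
  have hppos : (0:ℝ) < p := by rw [hpdef]; positivity
  have hp : 2 * A ≤ p * v := by
    rw [hAdef, hpdef, hvdef]
    push_cast
    rw [show (4:ℝ) ^ k = 2 ^ k * 2 ^ k by rw [← mul_pow]; norm_num]
    apply le_of_eq; ring
  set lev : Ω → ℕ → ℝ := fun x a => g x - A + a * v with hlev
  have hlevm : ∀ x, ∀ a b : ℕ, a < b → lev x a ≤ lev x b := by
    intro x a b hab
    have : (a:ℝ) ≤ b := by exact_mod_cast hab.le
    simp only [hlev]
    gcongr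
  have hcheb : ∀ i ∈ I, ∑ x ∈ s, (if A < |f i x - g x| then w x else 0) ≤ (1/8:ℝ) ^ (k+1) / 4 := by
    intro i hi
    have h1 : ∀ x ∈ s, A ^ 2 * (if A < |f i x - g x| then w x else 0) ≤ w x * (f i x - g x) ^ 2 := by
      intro x _
      split_ifs with h
      · rw [mul_comm, ← sq_abs (f i x - g x)]
        have := hw x
        gcongr
      · rw [mul_zero]; exact mul_nonneg (hw x) (sq_nonneg _)
    have h2 := Finset.sum_le_sum h1
    rw [← Finset.mul_sum] at h2
    have h3 := h2.trans (hloc i hi)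
    have h4 : 4 * r ^ 2 ≤ A ^ 2 * ((1/8:ℝ) ^ (k+1) / 4) := by
      have e1 : (1:ℝ) ≤ 2 ^ k := one_le_pow₀ (by norm_num)
      have : A ^ 2 * ((1/8:ℝ) ^ (k+1) / 4) = 8 * 2 ^ k * r ^ 2 := by
        rw [hAdef, mul_pow, mul_pow, ← pow_mul, mul_comm k 2, pow_mul, pow_succ (1/8:ℝ) k,
          show ((4:ℝ) ^ 2) = 2 * 8 by norm_num, mul_pow, one_div, inv_pow]
        field_simp
        norm_num
      rw [this]
      nlinarith [sq_nonneg r]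
    exact le_of_mul_le_mul_left (h3.trans h4) (by positivity)
  have main := abs_main (fun i (y : Ω × ℕ) => f i y.1 ≤ lev y.1 y.2)
      (fun i (y : Ω × ℕ) => lev y.1 y.2 + v ≤ f i y.1)
      (fun i y h1 h2 => absurd (h2.trans h1) (by linarith))
      (s ×ˢ Finset.range p) (fun y => w y.1 / p) (fun y => div_nonneg (hw _) hppos.le)
      (by
        rw [Finset.sum_product]
        simp only [Finset.sum_const, Finset.card_range, nsmul_eq_mul]
        rw [← hw1]
        refine Finset.sum_congr rfl fun x _ => ?_
        field_simp)
      I (4 * k + 12) V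
      (by
        intro i hi j hj hij
        rw [Finset.sum_product]
        have hpt : ∀ x ∈ s, ((if 2 ^ k * r / 4 ≤ |f i x - f j x| then w x else 0)
            - (if A < |f i x - g x| then w x else 0) - (if A < |f j x - g x| then w x else 0)) / p ≤
            ∑ a ∈ Finset.range p, (if PSep (fun i (y : Ω × ℕ) => f i y.1 ≤ lev y.1 y.2)
              (fun i (y : Ω × ℕ) => lev y.1 y.2 + v ≤ f i y.1) i j (x, a) then w x / p else 0) := by
          intro x _
          have hwx := hw x
          have hnn : ∀ a ∈ Finset.range p, 0 ≤ (if PSep (fun i (y : Ω × ℕ) => f i y.1 ≤ lev y.1 y.2)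
              (fun i (y : Ω × ℕ) => lev y.1 y.2 + v ≤ f i y.1) i j (x, a) then w x / (p:ℝ) else 0) := by
            intro a _; split_ifs <;> positivity
          by_cases hgood : 2 ^ k * r / 4 ≤ |f i x - f j x| ∧ |f i x - g x| ≤ A ∧ |f j x - g x| ≤ A
          · obtain ⟨g1, g2, g3⟩ := hgood
            rw [if_pos g1, if_neg (not_lt.2 g2), if_neg (not_lt.2 g3), sub_zero, sub_zero]
            have hex : ∃ a ∈ Finset.range p, PSep (fun i (y : Ω × ℕ) => f i y.1 ≤ lev y.1 y.2)
              (fun i (y : Ω × ℕ) => lev y.1 y.2 + v ≤ f i y.1) i j (x, a) := by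
              have h2v : 2 * v = 2 ^ k * r / 4 := by rw [hvdef]; ring
              rw [← h2v] at g1
              rcases le_abs.1 g1 with h | h
              · obtain ⟨a, ha, h1, h2⟩ := exists_level (f j x) (f i x) (g x) A v p hv hp
                  (by linarith) g3 g2
                exact ⟨a, ha, Or.inr ⟨h1, h2⟩⟩
              · obtain ⟨a, ha, h1, h2⟩ := exists_level (f i x) (f j x) (g x) A v p hv hp
                  (by linarith) g2 g3
                exact ⟨a, ha, Or.inl ⟨h1, h2⟩⟩
            obtain ⟨a, ha, hsepa⟩ := hex
            refine le_trans (le_of_eq ?_) (Finset.single_le_sum hnn ha)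
            rw [if_pos hsepa]
          · refine le_trans ?_ (Finset.sum_nonneg hnn)
            apply div_nonpos_of_nonpos_of_nonneg _ hppos.le
            by_cases g1 : 2 ^ k * r / 4 ≤ |f i x - f j x|
            · rw [if_pos g1]
              by_cases g2 : |f i x - g x| ≤ A
              · have g3 : A < |f j x - g x| := by
                  by_contra h
                  exact hgood ⟨g1, g2, not_lt.1 h⟩
                rw [if_pos g3]; split_ifs <;> linarith
              · rw [if_pos (not_le.1 g2)]; split_ifs <;> linarith
            · rw [if_neg g1]; split_ifs <;> linarith
        refine le_trans ?_ (Finset.sum_le_sum hpt)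
        rw [← Finset.sum_div, Finset.sum_sub_distrib, Finset.sum_sub_distrib, le_div_iff₀ hppos]
        have e1 := hcheb i hi
        have e2 := hcheb j hj
        have e3 := hsep i hi j hj hij
        have e4 : (1 / 2 : ℝ) ^ (4 * k + 12) * p = (1/8:ℝ) ^ (k+1) / 2 := by
          rw [hpdef, pow_add, pow_mul, pow_succ (1/8:ℝ) k]
          push_cast
          rw [show ((1/2:ℝ) ^ 4) = (1/8) * (1/2) by norm_num, mul_pow]
          have : ((1/2:ℝ)) ^ k * 2 ^ k = 1 := by rw [← mul_pow]; norm_num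
          calc _ = (1/8:ℝ)^k * (((1/2:ℝ)) ^ k * 2 ^ k) * ((1/2)^12 * 256) := by ring
            _ = _ := by rw [this]; norm_num; ring
        rw [e4]
        linarith)
      (by
        intro P hP
        obtain ⟨h1, h2⟩ := psh_shatters F f I hf v hv lev hlevm P hP
        rw [← h2]
        exact hVsh _ h1)
  refine (ENNReal.ofReal_le_ofReal main).trans ?_
  rw [ENNReal.ofReal_mul (by positivity)]
  push_cast
  rw [show (4 * (k:ℝ) + 12 + 5) = 4 * k + 17 by ring]
  gcongr

def RSep {ι : Type*} (R : ι → ι → Prop) (B : Finset ι) : Prop :=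
  ∀ i ∈ B, ∀ j ∈ B, i ≠ j → R i j

lemma exists_max_sep {ι : Type*} (A : Finset ι) (R : ι → ι → Prop) (hR : ∀ i j, R i j → R j i) :
    ∃ B ⊆ A, (∀ i ∈ B, ∀ j ∈ B, i ≠ j → R i j) ∧ ∀ i ∈ A, ∃ c ∈ B, i = c ∨ ¬ R i c := by
  obtain ⟨B, hB, hmax⟩ := Finset.exists_max_image
    (A.powerset.filter (fun B => RSep R B)) Finset.card
    ⟨∅, Finset.mem_filter.2 ⟨Finset.empty_mem_powerset _, by simp [RSep]⟩⟩
  rw [Finset.mem_filter, Finset.mem_powerset] at hB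
  refine ⟨B, hB.1, hB.2, ?_⟩
  intro i hi
  by_contra hcon
  push Not at hcon
  have hiB : i ∉ B := fun h => (hcon i h).1 rfl
  have := hmax (insert i B) (by
    rw [Finset.mem_filter, Finset.mem_powerset]
    refine ⟨Finset.insert_subset hi hB.1, ?_⟩
    intro a ha b hb hab
    rcases Finset.mem_insert.1 ha with ha' | ha' <;> rcases Finset.mem_insert.1 hb with hb' | hb'
    · exact absurd (ha'.trans hb'.symm) hab
    · rw [ha']; exact (hcon b hb').2
    · rw [hb']; exact hR _ _ (hcon a ha').2
    · exact hB.2 a ha' b hb' hab)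
  rw [Finset.card_insert_of_notMem hiB] at this
  omega

end LevelBound

section LocalBound
open Classical

noncomputable def locSum {Ω : Type*} (F : Set (Ω → ℝ)) (M : ℕ) (r : ℝ) : ℝ≥0∞ :=
  ∑ k ∈ Finset.range M, ENNReal.ofReal (4 * (4 * (k : ℝ) + 17) ^ 2) * combDim F (2 ^ k * r / 8)

lemma layer_bound (r x : ℝ) (hr : 0 < r) (hx : 0 ≤ x) (M : ℕ) (hxM : x < 2 ^ M * r / 2) :
    x ^ 2 ≤ r ^ 2 / 4 + ∑ k ∈ Finset.range M,
      4 ^ k * r ^ 2 * (if 2 ^ k * r / 2 ≤ x then (1:ℝ) else 0) := by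
  induction M with
  | zero => simp at hxM ⊢; nlinarith
  | succ M ih =>
    rw [Finset.sum_range_succ]
    by_cases h : x < 2 ^ M * r / 2
    · have := ih h
      rw [if_neg (not_le.2 h)]
      linarith
    · rw [if_pos (not_lt.1 h)]
      have h1 : x ^ 2 ≤ 4 ^ M * r ^ 2 := by
        have : x ≤ 2 ^ M * r := by
          have e : (2:ℝ) ^ (M + 1) * r / 2 = 2 ^ M * r := by rw [pow_succ]; ring
          linarith
        calc x ^ 2 ≤ (2 ^ M * r) ^ 2 := by gcongr
          _ = _ := by rw [mul_pow, ← pow_mul, mul_comm M 2, pow_mul]; norm_num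
      have h2 : 0 ≤ ∑ k ∈ Finset.range M,
          4 ^ k * r ^ 2 * (if 2 ^ k * r / 2 ≤ x then (1:ℝ) else 0) := by
        apply Finset.sum_nonneg
        intro k _
        split_ifs <;> positivity
      nlinarith [sq_nonneg r]

lemma local_bound {ι Ω : Type*} (F : Set (Ω → ℝ)) (s : Finset Ω) (w : Ω → ℝ)
    (hw : ∀ x, 0 ≤ w x) (hw1 : ∑ x ∈ s, w x = 1) (f : ι → Ω → ℝ) (I : Finset ι)
    (hf : ∀ i ∈ I, f i ∈ F) (g : Ω → ℝ) (r : ℝ) (hr : 0 < r) (M : ℕ)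
    (hM : ∀ i ∈ I, ∀ j ∈ I, ∀ x, |f i x - f j x| < 2 ^ M * r / 2)
    (hloc : ∀ i ∈ I, ∑ x ∈ s, w x * (f i x - g x) ^ 2 ≤ 4 * r ^ 2)
    (hsep : ∀ i ∈ I, ∀ j ∈ I, i ≠ j → r ^ 2 ≤ ∑ x ∈ s, w x * (f i x - f j x) ^ 2) :
    ENNReal.ofReal (Real.log I.card) ≤ locSum F M r := by
  set R : ℕ → ι → ι → Prop := fun k i j => (1 / 8 : ℝ) ^ (k + 1) ≤
      ∑ x ∈ s, if 2 ^ k * r / 4 ≤ |f i x - f j x| then w x else 0 with hRdef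
  have hRsymm : ∀ k i j, R k i j → R k j i := by
    intro k i j h
    simp only [hRdef] at h ⊢
    simpa only [abs_sub_comm] using h
  choose B hBI hBsep hBc using fun k => exists_max_sep I (R k) (hRsymm k)
  choose! c hcB hc using hBc
  rcases I.eq_empty_or_nonempty with hI | hI
  · simp [hI]
  have hinj : Set.InjOn (fun i => fun k : Fin M => c k i) (I : Set ι) := by
    intro i hi j hj hij
    by_contra hne
    have hmeas : ∀ k < M, ∑ x ∈ s, w x * (if 2 ^ k * r / 2 ≤ |f i x - f j x| then (1:ℝ) else 0) ≤
        2 * (1 / 8 : ℝ) ^ (k + 1) := by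
      intro k hk
      have hcij : c k i = c k j := congrFun hij ⟨k, hk⟩
      have aux : ∀ l ∈ I, ∑ x ∈ s, (if 2 ^ k * r / 4 ≤ |f l x - f (c k l) x| then w x else 0) ≤
          (1 / 8 : ℝ) ^ (k + 1) := by
        intro l hl
        rcases hc k l hl with h | h
        · rw [← h]
          have : ¬ (2 ^ k * r / 4 ≤ 0) := not_le.2 (by positivity)
          simp only [sub_self, abs_zero, this, if_false, Finset.sum_const_zero]
          positivity
        · exact (not_le.1 h).le
      have a1 := aux i hi
      have a2 := aux j hj
      rw [← hcij] at a2
      refine le_trans (Finset.sum_le_sum (g := fun x =>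
        (if 2 ^ k * r / 4 ≤ |f i x - f (c k i) x| then w x else 0) +
        (if 2 ^ k * r / 4 ≤ |f j x - f (c k i) x| then w x else 0)) ?_) ?_
      · intro x _
        have hwx := hw x
        by_cases h0 : 2 ^ k * r / 2 ≤ |f i x - f j x|
        · have htri : |f i x - f j x| ≤ |f i x - f (c k i) x| + |f j x - f (c k i) x| := by
            rw [abs_sub_comm (f j x)]
            exact abs_sub_le _ _ _
          rw [if_pos h0, mul_one]
          by_cases h1 : 2 ^ k * r / 4 ≤ |f i x - f (c k i) x|
          · rw [if_pos h1]; split_ifs <;> linarith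
          · rw [if_pos (show 2 ^ k * r / 4 ≤ |f j x - f (c k i) x| by linarith)]
            split_ifs; linarith
        · rw [if_neg h0, mul_zero]; split_ifs <;> linarith
      · rw [Finset.sum_add_distrib]; linarith
    have hd : ∑ x ∈ s, w x * (f i x - f j x) ^ 2 ≤ r ^ 2 / 4 +
        ∑ k ∈ Finset.range M, 4 ^ k * r ^ 2 * (2 * (1 / 8 : ℝ) ^ (k + 1)) := by
      calc ∑ x ∈ s, w x * (f i x - f j x) ^ 2 ≤ ∑ x ∈ s, w x * (r ^ 2 / 4 + ∑ k ∈ Finset.range M,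
          4 ^ k * r ^ 2 * (if 2 ^ k * r / 2 ≤ |f i x - f j x| then (1:ℝ) else 0)) := by
            refine Finset.sum_le_sum fun x _ => mul_le_mul_of_nonneg_left ?_ (hw x)
            rw [← sq_abs]
            exact layer_bound r _ hr (abs_nonneg _) M (hM i hi j hj x)
        _ = r ^ 2 / 4 + ∑ k ∈ Finset.range M, 4 ^ k * r ^ 2 *
            ∑ x ∈ s, w x * (if 2 ^ k * r / 2 ≤ |f i x - f j x| then (1:ℝ) else 0) := by
            simp only [mul_add, Finset.sum_add_distrib, ← Finset.sum_mul, hw1, one_mul]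
            congr 1
            simp only [Finset.mul_sum]
            rw [Finset.sum_comm]
            refine Finset.sum_congr rfl fun k _ => Finset.sum_congr rfl fun x _ => ?_
            ring
        _ ≤ _ := by
            gcongr with k hk
            exact hmeas k (Finset.mem_range.1 hk)
    have hgeo : ∑ k ∈ Finset.range M, 4 ^ k * r ^ 2 * (2 * (1 / 8 : ℝ) ^ (k + 1)) ≤ r ^ 2 / 2 := by
      have : ∀ k ∈ Finset.range M, 4 ^ k * r ^ 2 * (2 * (1 / 8 : ℝ) ^ (k + 1)) =
          r ^ 2 / 4 * (1 / (2:ℝ)) ^ k := by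
        intro k _
        rw [show (1 / (2:ℝ)) = 4 * (1 / 8) by norm_num, mul_pow, pow_succ]
        ring
      rw [Finset.sum_congr rfl this, ← Finset.mul_sum]
      have := sum_geometric_two_le M
      nlinarith [sq_nonneg r]
    have := hsep i hi j hj hne
    nlinarith
  have hcard : I.card ≤ ∏ k : Fin M, (B k).card := by
    rw [← Fintype.card_piFinset]
    apply Finset.card_le_card_of_injOn _ _ hinj
    intro i hi
    simp only [Set.mem_pi, Fintype.coe_piFinset]
    intro k _
    exact hcB k i hi
  rw [← Finset.prod_range (fun k => (B k).card)] at hcard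
  have hBpos : ∀ k, 0 < (B k).card := by
    intro k
    obtain ⟨i, hi⟩ := hI
    exact Finset.card_pos.2 ⟨_, hcB k i hi⟩
  have hlog : Real.log I.card ≤ ∑ k ∈ Finset.range M, Real.log (B k).card := by
    rw [← Real.log_prod (fun k _ => by exact_mod_cast (hBpos k).ne')]
    apply Real.log_le_log
    · exact_mod_cast Finset.card_pos.2 hI
    · exact_mod_cast hcard
  refine (ENNReal.ofReal_le_ofReal hlog).trans ?_
  rw [ENNReal.ofReal_sum_of_nonneg (fun k _ => Real.log_natCast_nonneg _), locSum]
  refine Finset.sum_le_sum fun k _ => ?_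
  exact level_bound F s w hw hw1 f (B k) (fun i hi => hf i (hBI k hi)) g r hr k
    (fun i hi => hloc i (hBI k hi)) (hBsep k)

lemma entropy_step {Ω : Type*} (F : Set (Ω → ℝ)) (r : ℝ) (hr : 0 < r) (M : ℕ)
    (hM : ∀ f ∈ F, ∀ g ∈ F, ∀ x, |f x - g x| < 2 ^ M * r / 2) :
    KPentropy F r ≤ KPentropy F (2 * r) + locSum F M r := by
  refine iSup₂_le fun m hm => ?_
  obtain ⟨s, w, f, hw, hw1, hf, hsep⟩ := hm
  rcases Nat.eq_zero_or_pos m with hm0 | hmpos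
  · simp [hm0]
  have hsep' : ∀ i j : Fin m, i ≠ j → r ^ 2 ≤ ∑ x ∈ s, w x * (f i x - f j x) ^ 2 := by
    intro i j hij
    rcases lt_or_gt_of_ne hij with h | h
    · exact hsep i j h
    · have := hsep j i h
      simpa only [sub_sq_comm] using this
  obtain ⟨B, _, hBsep, hBc⟩ := exists_max_sep (Finset.univ : Finset (Fin m))
    (fun i j => (2 * r) ^ 2 ≤ ∑ x ∈ s, w x * (f i x - f j x) ^ 2)
    (fun i j h => by simpa only [sub_sq_comm] using h)
  choose! c hcB hc using hBc
  have hBne : B.Nonempty := ⟨_, hcB ⟨0, hmpos⟩ (Finset.mem_univ _)⟩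
  have hBsepD : KPSeparated F (2 * r) B.card := by
    refine ⟨s, w, fun i => f (B.equivFin.symm i), hw, hw1, fun i => hf _, ?_⟩
    intro i j hij
    refine hBsep _ (Finset.coe_mem _) _ (Finset.coe_mem _) ?_
    intro h
    have := B.equivFin.symm.injective (Subtype.ext h)
    exact hij.ne this
  obtain ⟨b, hb, hbmax⟩ := Finset.exists_max_image B
    (fun b => ((Finset.univ : Finset (Fin m)).filter (fun i => c i = b)).card) hBne
  set I := (Finset.univ : Finset (Fin m)).filter (fun i => c i = b) with hIdef
  have hcount : m ≤ B.card * I.card := by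
    have h1 := Finset.card_eq_sum_card_fiberwise (f := c) (s := (Finset.univ : Finset (Fin m)))
      (t := B) (fun i hi => hcB i (Finset.mem_univ _))
    simp only [Finset.card_univ, Fintype.card_fin] at h1
    calc m = _ := h1
      _ ≤ ∑ _b ∈ B, I.card := Finset.sum_le_sum hbmax
      _ = _ := by simp
  have hIpos : 0 < I.card := by
    rcases Nat.eq_zero_or_pos I.card with h | h
    · rw [h] at hcount; omega
    · exact h
  have hBpos : 0 < B.card := Finset.card_pos.2 hBne
  have hlog : Real.log m ≤ Real.log B.card + Real.log I.card := by
    rw [← Real.log_mul (by exact_mod_cast hBpos.ne') (by exact_mod_cast hIpos.ne')]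
    apply Real.log_le_log
    · exact_mod_cast hmpos
    · exact_mod_cast hcount
  refine (ENNReal.ofReal_le_ofReal hlog).trans ?_
  rw [ENNReal.ofReal_add (Real.log_natCast_nonneg _) (Real.log_natCast_nonneg _)]
  refine add_le_add (le_iSup₂_of_le B.card hBsepD le_rfl) ?_
  refine local_bound F s w hw hw1 f I (fun i _ => hf i) (f b) r hr M
    (fun i _ j _ x => hM _ (hf i) _ (hf j) x) ?_ (fun i _ j _ hij => hsep' i j hij)
  intro i hi
  have hcb : c i = b := (Finset.mem_filter.1 hi).2
  rcases hc i (Finset.mem_univ _) with h | h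
  · rw [h, hcb]; simp; positivity
  · rw [hcb] at h
    have := (not_le.1 h).le
    linarith

end LocalBound

section Integrals
open Classical

lemma shatters_anti {Ω : Type*} {F : Set (Ω → ℝ)} {t t' : ℝ} (h : t ≤ t') {σ : Finset Ω}
    (hs : Shatters F t' σ) : Shatters F t σ := by
  obtain ⟨g, hg⟩ := hs
  refine ⟨g, fun τ hτ => ?_⟩
  obtain ⟨f, hf, h1, h2⟩ := hg τ hτ
  exact ⟨f, hf, h1, fun x hx => by linarith [h2 x hx]⟩

lemma combDim_anti {Ω : Type*} (F : Set (Ω → ℝ)) : Antitone (combDim F) := by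
  intro t t' h
  exact iSup₂_le fun σ hσ => le_iSup₂_of_le σ (shatters_anti h hσ) le_rfl

lemma sqrt_combDim_measurable {Ω : Type*} (F : Set (Ω → ℝ)) :
    Measurable (fun t => (combDim F t) ^ (1/2 : ℝ)) := by
  apply Antitone.measurable
  intro t t' h
  exact ENNReal.rpow_le_rpow (combDim_anti F h) (by norm_num)

lemma lintegral_scale (φ : ℝ → ℝ≥0∞) (hφ : Measurable φ) (a : ℝ) (ha : 0 < a) :
    ∫⁻ t in Set.Ioi (0:ℝ), φ (a * t) = ENNReal.ofReal a⁻¹ * ∫⁻ t in Set.Ioi (0:ℝ), φ t := by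
  rw [← lintegral_indicator measurableSet_Ioi, ← lintegral_indicator measurableSet_Ioi]
  have h1 : (Set.Ioi (0:ℝ)).indicator (fun t => φ (a * t)) =
      fun t => (Set.Ioi (0:ℝ)).indicator φ (a * t) := by
    funext t
    by_cases ht : 0 < t
    · rw [Set.indicator_of_mem (Set.mem_Ioi.2 ht), Set.indicator_of_mem (Set.mem_Ioi.2 (mul_pos ha ht))]
    · rw [Set.indicator_of_notMem (by simpa using ht), Set.indicator_of_notMem]
      simp only [Set.mem_Ioi, not_lt] at ht ⊢
      exact mul_nonpos_of_nonneg_of_nonpos ha.le ht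
  rw [h1, ← lintegral_map (hφ.indicator measurableSet_Ioi) (measurable_const_mul a),
    Real.map_volume_mul_left ha.ne', lintegral_smul_measure, abs_of_pos (inv_pos.2 ha), smul_eq_mul]

lemma sqrt_sum_le {κ : Type*} (s : Finset κ) (g : κ → ℝ≥0∞) :
    (∑ k ∈ s, g k) ^ (1/2 : ℝ) ≤ ∑ k ∈ s, (g k) ^ (1/2 : ℝ) := by
  induction s using Finset.induction_on with
  | empty => simp
  | insert a s ha ih =>
    rw [Finset.sum_insert ha, Finset.sum_insert ha]
    refine (ENNReal.rpow_add_le_add_rpow _ _ (by norm_num) (by norm_num)).trans ?_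
    gcongr

lemma entropy_iter {Ω : Type*} (F : Set (Ω → ℝ)) (r : ℝ) (hr : 0 < r) (M : ℕ)
    (hM : ∀ f ∈ F, ∀ g ∈ F, ∀ x, |f x - g x| < 2 ^ M * r / 2) (J : ℕ) :
    KPentropy F r ≤ KPentropy F (2 ^ J * r) + ∑ j ∈ Finset.range J, locSum F M (2 ^ j * r) := by
  induction J with
  | zero => simp
  | succ J ih =>
    rw [Finset.sum_range_succ]
    have h1 : (1:ℝ) ≤ 2 ^ J := one_le_pow₀ (by norm_num)
    have := entropy_step F (2 ^ J * r) (by positivity) M (fun f hf g hg x => by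
      refine (hM f hf g hg x).trans_le ?_
      have : r ≤ 2 ^ J * r := by nlinarith
      gcongr)
    rw [show 2 * (2 ^ J * r) = 2 ^ (J + 1) * r by rw [pow_succ]; ring] at this
    calc _ ≤ _ := ih
      _ ≤ (KPentropy F (2 ^ (J + 1) * r) + locSum F M (2 ^ J * r)) + _ := by gcongr
      _ = _ := by ring

lemma entropy_zero {Ω : Type*} (F : Set (Ω → ℝ)) (r : ℝ) (hr : 0 < r)
    (hM : ∀ f ∈ F, ∀ g ∈ F, ∀ x, |f x - g x| < r / 2) : KPentropy F r = 0 := by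
  rw [← nonpos_iff_eq_zero]
  refine iSup₂_le fun m hm => ?_
  obtain ⟨s, w, f, hw, hw1, hf, hsep⟩ := hm
  have hm1 : m ≤ 1 := by
    by_contra hcon
    push Not at hcon
    have h1 := hsep ⟨0, by omega⟩ ⟨1, hcon⟩ (by simp)
    have h2 : ∀ x ∈ s, w x * (f ⟨0, by omega⟩ x - f ⟨1, hcon⟩ x) ^ 2 ≤ w x * (r / 2) ^ 2 := by
      intro x _
      have := (hM _ (hf ⟨0, by omega⟩) _ (hf ⟨1, hcon⟩) x).le
      refine mul_le_mul_of_nonneg_left ?_ (hw x)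
      rw [← sq_abs]
      gcongr
    have h3 := h1.trans (Finset.sum_le_sum h2)
    rw [← Finset.sum_mul, hw1] at h3
    nlinarith
  have : Real.log m ≤ 0 := Real.log_nonpos (by positivity) (by exact_mod_cast hm1)
  simp [ENNReal.ofReal_of_nonpos this]

noncomputable def gsum {Ω : Type*} (F : Set (Ω → ℝ)) (r : ℝ) : ℝ≥0∞ :=
  ∑' j : ℕ, ∑' k : ℕ, ENNReal.ofReal (2 * (4 * (k : ℝ) + 17)) *
    (combDim F ((2 ^ k * 2 ^ j / 8) * r)) ^ (1/2 : ℝ)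

lemma sqrt_entropy_le {Ω : Type*} (F : Set (Ω → ℝ)) (T : ℝ)
    (hT : ∀ f ∈ F, ∀ g ∈ F, ∀ x, |f x - g x| < T) (r : ℝ) (hr : 0 < r) :
    (KPentropy F r) ^ (1/2 : ℝ) ≤ gsum F r := by
  obtain ⟨M, hMT⟩ := pow_unbounded_of_one_lt (2 * T / r) (by norm_num : (1:ℝ) < 2)
  rw [div_lt_iff₀ hr] at hMT
  have hM : ∀ f ∈ F, ∀ g ∈ F, ∀ x, |f x - g x| < 2 ^ M * r / 2 := by
    intro f hf g hg x
    have := hT f hf g hg x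
    linarith
  have h1 := entropy_iter F r hr M hM M
  rw [entropy_zero F (2 ^ M * r) (by positivity) hM, zero_add] at h1
  calc (KPentropy F r) ^ (1/2 : ℝ)
      ≤ (∑ j ∈ Finset.range M, locSum F M (2 ^ j * r)) ^ (1/2 : ℝ) :=
        ENNReal.rpow_le_rpow h1 (by norm_num)
    _ ≤ ∑ j ∈ Finset.range M, (locSum F M (2 ^ j * r)) ^ (1/2 : ℝ) := sqrt_sum_le _ _
    _ ≤ ∑ j ∈ Finset.range M, ∑' k : ℕ, ENNReal.ofReal (2 * (4 * (k : ℝ) + 17)) *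
          (combDim F ((2 ^ k * 2 ^ j / 8) * r)) ^ (1/2 : ℝ) := by
        refine Finset.sum_le_sum fun j _ => ?_
        refine le_trans ?_ (ENNReal.sum_le_tsum (Finset.range M))
        rw [locSum]
        refine (sqrt_sum_le _ _).trans (le_of_eq ?_)
        refine Finset.sum_congr rfl fun k _ => ?_
        rw [ENNReal.mul_rpow_of_nonneg _ _ (by norm_num)]
        congr 1
        · rw [ENNReal.ofReal_rpow_of_nonneg (by positivity) (by norm_num),
            show 4 * (4 * (k:ℝ) + 17) ^ 2 = (2 * (4 * (k:ℝ) + 17)) ^ 2 by ring,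
            ← Real.sqrt_eq_rpow, Real.sqrt_sq (by positivity)]
        · congr 2; ring
    _ ≤ _ := ENNReal.sum_le_tsum _

noncomputable def bigC : ℝ≥0∞ :=
  ∑' j : ℕ, ∑' k : ℕ, ENNReal.ofReal (2 * (4 * (k : ℝ) + 17)) *
    ENNReal.ofReal (2 ^ k * 2 ^ j / 8 : ℝ)⁻¹

lemma bigC_ne_top : bigC ≠ ⊤ := by
  have h1 : ∀ j k : ℕ, ENNReal.ofReal (2 * (4 * (k : ℝ) + 17)) *
      ENNReal.ofReal (2 ^ k * 2 ^ j / 8 : ℝ)⁻¹ =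
      ENNReal.ofReal ((1/2:ℝ) ^ j) * ENNReal.ofReal (16 * (4 * (k:ℝ) + 17) * (1/2) ^ k) := by
    intro j k
    rw [← ENNReal.ofReal_mul (by positivity), ← ENNReal.ofReal_mul (by positivity)]
    congr 1
    rw [one_div, inv_pow, inv_pow]
    field_simp
    norm_num
  have hs1 : Summable (fun j : ℕ => (1/2:ℝ) ^ j) := summable_geometric_two
  have hs2 : Summable (fun k : ℕ => 16 * (4 * (k:ℝ) + 17) * (1/2:ℝ) ^ k) := by
    have a := summable_pow_mul_geometric_of_norm_lt_one 1 (r := (1/2:ℝ)) (by norm_num)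
    have : (fun k : ℕ => 16 * (4 * (k:ℝ) + 17) * (1/2:ℝ) ^ k) =
        fun k : ℕ => 64 * ((k:ℝ) ^ 1 * (1/2:ℝ) ^ k) + 272 * (1/2:ℝ) ^ k := by
      funext k; ring
    rw [this]
    exact (a.mul_left _).add (hs1.mul_left _)
  simp only [bigC, h1, ENNReal.tsum_mul_left, ENNReal.tsum_mul_right]
  rw [← ENNReal.ofReal_tsum_of_nonneg (fun _ => by positivity) hs1,
    ← ENNReal.ofReal_tsum_of_nonneg (fun _ => by positivity) hs2]
  exact ENNReal.mul_ne_top ENNReal.ofReal_ne_top ENNReal.ofReal_ne_top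

lemma lintegral_gsum {Ω : Type*} (F : Set (Ω → ℝ)) :
    ∫⁻ t in Set.Ioi (0:ℝ), gsum F t = bigC * ∫⁻ t in Set.Ioi (0:ℝ), (combDim F t) ^ (1/2 : ℝ) := by
  have hm : ∀ a : ℝ, Measurable (fun t => (combDim F (a * t)) ^ (1/2 : ℝ)) := fun a =>
    (sqrt_combDim_measurable F).comp (measurable_const_mul a)
  unfold gsum bigC
  rw [lintegral_tsum]
  · rw [← ENNReal.tsum_mul_right]
    congr 1; funext j
    rw [lintegral_tsum]
    · rw [← ENNReal.tsum_mul_right]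
      congr 1; funext k
      rw [lintegral_const_mul _ (hm _), mul_assoc]
      congr 1
      exact lintegral_scale _ (sqrt_combDim_measurable F) _ (by positivity)
    · intro k
      exact ((hm _).const_mul _).aemeasurable
  · intro j
    exact (Measurable.ennreal_tsum fun k => (hm _).const_mul _).aemeasurable

lemma upper_bound {Ω : Type*} (F : Set (Ω → ℝ)) :
    (∫⁻ t in Set.Ioi (0 : ℝ), (KPentropy F t) ^ (1/2 : ℝ)) ≤
      ENNReal.ofReal (bigC.toReal + 1) * (∫⁻ t in Set.Ioi (0 : ℝ), (combDim F t) ^ (1/2 : ℝ)) := by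
  by_cases hcase : ∀ t > (0:ℝ), 1 ≤ combDim F t
  · have : (∫⁻ t in Set.Ioi (0 : ℝ), (combDim F t) ^ (1/2 : ℝ)) = ⊤ := by
      rw [← top_le_iff]
      calc ⊤ = ∫⁻ t in Set.Ioi (0 : ℝ), (1 : ℝ≥0∞) := by simp
        _ ≤ _ := by
          apply setLIntegral_mono (sqrt_combDim_measurable F)
          intro t ht
          exact ENNReal.one_le_rpow (hcase t ht) (by norm_num)
    rw [this, ENNReal.mul_top]
    · exact le_top
    · simp only [ne_eq, ENNReal.ofReal_eq_zero, not_le]; positivity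
  · push Not at hcase
    obtain ⟨T, hT0, hT⟩ := hcase
    have hT' : ∀ f ∈ F, ∀ g ∈ F, ∀ x, f x - g x < T := by
      intro f hf g hg x
      by_contra hcon
      push Not at hcon
      have hsh : Shatters F T {x} := by
        refine ⟨g, fun τ hτ => ?_⟩
        by_cases hx : x ∈ τ
        · refine ⟨f, hf, ?_, ?_⟩
          · intro y hy hy'
            rw [Finset.mem_singleton] at hy
            exact absurd (hy ▸ hx) hy'
          · intro y hy
            have := Finset.mem_singleton.1 (hτ hy)
            rw [this]; linarith
        · refine ⟨g, hg, fun y _ _ => le_rfl, ?_⟩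
          intro y hy
          have := Finset.mem_singleton.1 (hτ hy)
          exact absurd (this ▸ hy) hx
      have : (1 : ℝ≥0∞) ≤ combDim F T := le_iSup₂_of_le {x} hsh (by simp)
      exact absurd hT (not_lt.2 this)
    have hTabs : ∀ f ∈ F, ∀ g ∈ F, ∀ x, |f x - g x| < T := by
      intro f hf g hg x
      rw [abs_lt]
      have := hT' f hf g hg x
      have := hT' g hg f hf x
      constructor <;> linarith
    calc _ ≤ ∫⁻ t in Set.Ioi (0:ℝ), gsum F t := by
          apply setLIntegral_mono' measurableSet_Ioi
          intro t ht
          exact sqrt_entropy_le F T hTabs t ht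
      _ = _ := lintegral_gsum F
      _ ≤ _ := by
          gcongr
          calc bigC = ENNReal.ofReal bigC.toReal := (ENNReal.ofReal_toReal bigC_ne_top).symm
            _ ≤ _ := ENNReal.ofReal_le_ofReal (by linarith)

lemma kp_anti {Ω : Type*} (F : Set (Ω → ℝ)) {t t' : ℝ} (ht : 0 ≤ t) (h : t ≤ t') :
    KPentropy F t' ≤ KPentropy F t := by
  refine iSup₂_le fun m hm => le_iSup₂_of_le m ?_ le_rfl
  obtain ⟨s, w, f, hw, hw1, hf, hsep⟩ := hm
  exact ⟨s, w, f, hw, hw1, hf, fun i j hij => le_trans (by gcongr) (hsep i j hij)⟩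

lemma ball_bound {Ω : Type*} (σ c : Finset Ω) (hc : c ⊆ σ) :
    ((σ.powerset.filter (fun τ => ((symmDiff τ c).card : ℝ) < σ.card / 8)).card : ℝ) ≤
      (Real.exp (1/8) * (Real.exp (-1) + 1)) ^ σ.card := by
  have h1 : ∑ τ ∈ σ.powerset, Real.exp (-1) ^ (symmDiff τ c).card = (Real.exp (-1) + 1) ^ σ.card := by
    have := Finset.sum_pow_mul_eq_add_pow (Real.exp (-1)) 1 σ
    simp only [one_pow, mul_one] at this
    rw [← this]
    have hmem : ∀ τ ∈ σ.powerset, symmDiff τ c ∈ σ.powerset := by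
      intro τ hτ
      rw [Finset.mem_powerset] at hτ ⊢
      intro x hx
      rw [Finset.mem_symmDiff] at hx
      rcases hx with h | h
      · exact hτ h.1
      · exact hc h.1
    exact Finset.sum_nbij' (fun τ => symmDiff τ c) (fun τ => symmDiff τ c) hmem hmem
      (fun τ _ => by simp) (fun τ _ => by simp) (fun τ _ => rfl)
  rw [mul_pow, ← h1, Finset.mul_sum]
  calc _ = ∑ τ ∈ σ.powerset.filter (fun τ => ((symmDiff τ c).card : ℝ) < σ.card / 8), (1:ℝ) := by simp
    _ ≤ ∑ τ ∈ σ.powerset.filter (fun τ => ((symmDiff τ c).card : ℝ) < σ.card / 8),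
        Real.exp (1/8) ^ σ.card * Real.exp (-1) ^ (symmDiff τ c).card := by
        refine Finset.sum_le_sum fun τ hτ => ?_
        have := (Finset.mem_filter.1 hτ).2
        rw [← Real.exp_nat_mul, ← Real.exp_nat_mul, ← Real.exp_add]
        apply Real.one_le_exp
        linarith
    _ ≤ _ := Finset.sum_le_sum_of_subset_of_nonneg (Finset.filter_subset _ _)
        (fun τ _ _ => by positivity)

lemma combDim_le {Ω : Type*} (F : Set (Ω → ℝ)) (t : ℝ) (ht : 0 < t) :
    combDim F t ≤ 9 * KPentropy F ((1/3) * t) := by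
  refine iSup₂_le fun σ hσ => ?_
  rcases σ.eq_empty_or_nonempty with h0 | hne
  · simp [h0]
  have hn : 0 < σ.card := Finset.card_pos.2 hne
  have hnr : (0:ℝ) < σ.card := by exact_mod_cast hn
  obtain ⟨h, hh⟩ := hσ
  choose! f hf hlow hhigh using hh
  obtain ⟨B, hBs, hBsep, hBc⟩ := exists_max_sep σ.powerset
    (fun τ τ' => ¬ ((symmDiff τ τ').card : ℝ) < σ.card / 8)
    (fun τ τ' h => by rwa [symmDiff_comm])
  have hcover : σ.powerset ⊆ B.biUnion (fun c => σ.powerset.filter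
      (fun τ => ((symmDiff τ c).card : ℝ) < σ.card / 8)) := by
    intro τ hτ
    obtain ⟨c, hc, h⟩ := hBc τ hτ
    refine Finset.mem_biUnion.2 ⟨c, hc, Finset.mem_filter.2 ⟨hτ, ?_⟩⟩
    rcases h with h | h
    · rw [h]; simp [hnr]
    · exact not_not.1 h
  set β : ℝ := Real.exp (1/8) * (Real.exp (-1) + 1) with hβ
  have hcount : (2:ℝ) ^ σ.card ≤ B.card * β ^ σ.card := by
    have h1 := (Finset.card_le_card hcover).trans Finset.card_biUnion_le
    rw [Finset.card_powerset] at h1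
    have h2 : ((2:ℝ) ^ σ.card) ≤ ∑ c ∈ B, ((σ.powerset.filter
      (fun τ => ((symmDiff τ c).card : ℝ) < σ.card / 8)).card : ℝ) := by exact_mod_cast h1
    calc _ ≤ _ := h2
      _ ≤ ∑ c ∈ B, β ^ σ.card := Finset.sum_le_sum fun c hc =>
          ball_bound σ c (Finset.mem_powerset.1 (hBs hc))
      _ = _ := by simp
  have hβ2 : β * Real.exp (1/9) ≤ 2 := by
    have e1 : Real.exp (-1) ≤ 0.37 := by linarith [Real.exp_neg_one_lt_d9]
    have e2 : Real.exp (1/8) * Real.exp (1/9) ≤ 1.4 := by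
      rw [← Real.exp_add]
      have := Real.exp_bound_div_one_sub_of_interval (x := 1/8 + 1/9) (by norm_num) (by norm_num)
      refine this.trans (by norm_num)
    have e3 := Real.exp_pos (-1)
    calc β * Real.exp (1/9) = (Real.exp (1/8) * Real.exp (1/9)) * (Real.exp (-1) + 1) := by
          rw [hβ]; ring
      _ ≤ 1.4 * (0.37 + 1) := by gcongr
      _ ≤ 2 := by norm_num
  have hβpos : 0 < β := by positivity
  have hBlog : (σ.card : ℝ) / 9 ≤ Real.log B.card := by
    have h1 : β ^ σ.card * Real.exp (σ.card / 9) ≤ β ^ σ.card * B.card := by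
      calc β ^ σ.card * Real.exp (σ.card / 9) = (β * Real.exp (1/9)) ^ σ.card := by
            rw [mul_pow β, ← Real.exp_nat_mul (1/9)]; congr 2; ring
        _ ≤ 2 ^ σ.card := pow_le_pow_left₀ (by positivity) hβ2 _
        _ ≤ _ := by rw [mul_comm]; exact hcount
    have h2 := le_of_mul_le_mul_left h1 (by positivity)
    have := Real.log_le_log (Real.exp_pos _) h2
    rwa [Real.log_exp] at this
  have hKP : KPSeparated F ((1/3) * t) B.card := by
    refine ⟨σ, fun _ => 1 / σ.card, fun i => f (B.equivFin.symm i), fun _ => by positivity, ?_, ?_, ?_⟩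
    · simp; field_simp
    · intro i
      exact hf _ (Finset.mem_powerset.1 (hBs (Finset.coe_mem _)))
    · intro i j hij
      set τ : Finset Ω := (B.equivFin.symm i : Finset Ω) with hτ
      set τ' : Finset Ω := (B.equivFin.symm j : Finset Ω) with hτ'
      have hτB : τ ∈ B := Finset.coe_mem _
      have hτB' : τ' ∈ B := Finset.coe_mem _
      have hne : τ ≠ τ' := by
        intro h
        exact hij.ne (B.equivFin.symm.injective (Subtype.ext h))
      have hτs := Finset.mem_powerset.1 (hBs hτB)
      have hτs' := Finset.mem_powerset.1 (hBs hτB')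
      have hd := not_lt.1 (hBsep τ hτB τ' hτB' hne)
      have hsub : symmDiff τ τ' ⊆ σ := by
        intro x hx
        rw [Finset.mem_symmDiff] at hx
        rcases hx with h | h
        · exact hτs h.1
        · exact hτs' h.1
      have hpt : ∀ x ∈ symmDiff τ τ', 1 / (σ.card : ℝ) * t ^ 2 ≤
          1 / (σ.card : ℝ) * (f τ x - f τ' x) ^ 2 := by
        intro x hx
        refine mul_le_mul_of_nonneg_left ?_ (by positivity)
        have hxσ := hsub hx
        rw [Finset.mem_symmDiff] at hx
        rcases hx with ⟨ha, hb⟩ | ⟨ha, hb⟩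
        · have a1 := hhigh τ hτs x ha
          have a2 := hlow τ' hτs' x hxσ hb
          nlinarith
        · have a1 := hhigh τ' hτs' x ha
          have a2 := hlow τ hτs x hxσ hb
          nlinarith
      calc ((1/3) * t) ^ 2 ≤ (1/8) * t ^ 2 := by nlinarith [sq_nonneg t]
        _ = (σ.card / 8 : ℝ) * (1 / (σ.card : ℝ) * t ^ 2) := by field_simp
        _ ≤ ((symmDiff τ τ').card : ℝ) * (1 / (σ.card : ℝ) * t ^ 2) := by gcongr
        _ = ∑ x ∈ symmDiff τ τ', 1 / (σ.card : ℝ) * t ^ 2 := by simp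
        _ ≤ ∑ x ∈ symmDiff τ τ', 1 / (σ.card : ℝ) * (f τ x - f τ' x) ^ 2 := Finset.sum_le_sum hpt
        _ ≤ _ := Finset.sum_le_sum_of_subset_of_nonneg hsub (fun x _ _ => by positivity)
  have h1 : ENNReal.ofReal (Real.log B.card) ≤ KPentropy F ((1/3) * t) :=
    le_iSup₂_of_le B.card hKP le_rfl
  calc (σ.card : ℝ≥0∞) = ENNReal.ofReal (9 * (σ.card / 9)) := by
        rw [mul_div_cancel₀ _ (by norm_num)]; simp
    _ ≤ ENNReal.ofReal (9 * Real.log B.card) := by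
        apply ENNReal.ofReal_le_ofReal; linarith
    _ = 9 * ENNReal.ofReal (Real.log B.card) := by
        rw [ENNReal.ofReal_mul (by norm_num)]; simp
    _ ≤ _ := by gcongr

lemma lower_bound {Ω : Type*} (F : Set (Ω → ℝ)) :
    ENNReal.ofReal (1/9) * (∫⁻ t in Set.Ioi (0 : ℝ), (combDim F t) ^ (1/2 : ℝ)) ≤
          (∫⁻ t in Set.Ioi (0 : ℝ), (KPentropy F t) ^ (1/2 : ℝ)) := by
  set φ : ℝ → ℝ≥0∞ := fun t => (KPentropy F (max t 0)) ^ (1/2 : ℝ) with hφ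
  have hφm : Measurable φ := by
    apply Antitone.measurable
    intro t t' h
    exact ENNReal.rpow_le_rpow (kp_anti F (le_max_right _ _) (max_le_max_right 0 h)) (by norm_num)
  have h1 : ∫⁻ t in Set.Ioi (0 : ℝ), (KPentropy F t) ^ (1/2 : ℝ) = ∫⁻ t in Set.Ioi (0 : ℝ), φ t := by
    apply setLIntegral_congr_fun measurableSet_Ioi
    intro t ht
    simp only [hφ, max_eq_left (le_of_lt (Set.mem_Ioi.1 ht))]
  rw [h1]
  have h2 : ∫⁻ t in Set.Ioi (0 : ℝ), (combDim F t) ^ (1/2 : ℝ) ≤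
      ∫⁻ t in Set.Ioi (0 : ℝ), 3 * φ ((1/3) * t) := by
    apply setLIntegral_mono' measurableSet_Ioi
    intro t ht
    have ht' : (0:ℝ) < t := ht
    have := ENNReal.rpow_le_rpow (combDim_le F t ht') (by norm_num : (0:ℝ) ≤ 1/2)
    refine this.trans (le_of_eq ?_)
    rw [ENNReal.mul_rpow_of_nonneg _ _ (by norm_num)]
    simp only [hφ]
    rw [max_eq_left (by positivity)]
    congr 1
    rw [show (9:ℝ≥0∞) = 3 ^ (2:ℝ) by norm_num, ← ENNReal.rpow_mul]
    norm_num
  have hφ3 : Measurable (fun t => φ ((1/3) * t)) := hφm.comp (measurable_const_mul _)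
  rw [lintegral_const_mul _ hφ3,
    lintegral_scale φ hφm (1/3) (by norm_num)] at h2
  calc _ ≤ ENNReal.ofReal (1/9) * (3 * (ENNReal.ofReal (1/3)⁻¹ * ∫⁻ t in Set.Ioi (0 : ℝ), φ t)) := by gcongr
    _ = (ENNReal.ofReal (1/9) * ENNReal.ofReal 3 * ENNReal.ofReal (1/3)⁻¹) * ∫⁻ t in Set.Ioi (0 : ℝ), φ t := by
        rw [show (3:ℝ≥0∞) = ENNReal.ofReal 3 by simp]; ring
    _ = _ := by
        rw [← ENNReal.ofReal_mul (by norm_num), ← ENNReal.ofReal_mul (by norm_num)]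
        norm_num

end Integrals

/-- For every class `F` of real-valued functions on a set `Ω`, the entropy
integral and the dimension integral are equivalent up to absolute constant factors:
`c·∫₀^∞ √(v(F,t)) dt ≤ ∫₀^∞ √(D(F,t)) dt ≤ C·∫₀^∞ √(v(F,t)) dt`. -/
theorem entropy_integral_equiv_dimension_integral :
    ∃ c > (0 : ℝ), ∃ C > (0 : ℝ), ∀ (Ω : Type) (F : Set (Ω → ℝ)),
      ENNReal.ofReal c * (∫⁻ t in Set.Ioi (0 : ℝ), (combDim F t) ^ (1/2 : ℝ)) ≤
          (∫⁻ t in Set.Ioi (0 : ℝ), (KPentropy F t) ^ (1/2 : ℝ)) ∧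
      (∫⁻ t in Set.Ioi (0 : ℝ), (KPentropy F t) ^ (1/2 : ℝ)) ≤
          ENNReal.ofReal C * (∫⁻ t in Set.Ioi (0 : ℝ), (combDim F t) ^ (1/2 : ℝ)) := by
  refine ⟨1/9, by norm_num, bigC.toReal + 1, by positivity, fun Ω F => ?_⟩
  exact ⟨lower_bound F, upper_bound F⟩
end

section
/- Let F be a class of real-valued functions on a set Ω satisfying the minimal regularity assumption: there exists a > 1 such that v(F, a t) ≤ (1/2)·v(F, t) for all t > 0. Then for all t > 0, c·v(F, 2t) ≤ D(F, t) ≤ C·v(F, c t), where c > 0 is an absolute constant and C depends only on a. -/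
open MeasureTheory Filter
open scoped ENNReal NNReal Pointwise BigOperators

def PShat {α T : Type*} (lo hi : α → T → Prop) (A : Finset α) (η : Finset T) : Prop :=
  ∀ τ : Finset T, τ ⊆ η → ∃ f ∈ A, (∀ x ∈ η, x ∉ τ → lo f x) ∧ (∀ x ∈ τ, hi f x)

open Classical in
lemma pshat_count {α T : Type*} [Fintype T] (lo hi : α → T → Prop)
    (hex : ∀ f x, lo f x → hi f x → False) (P : ℕ) (hP : 2 ≤ P) (Q : Finset α)
    (hs : ∀ A ⊆ Q, 2 ≤ A.card → ∃ x, A.card ≤ P * (A.filter (fun f => lo f x)).card ∧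
      A.card ≤ P * (A.filter (fun f => hi f x)).card) (n : ℕ) :
    ∀ A ⊆ Q, P ^ n ≤ A.card →
      2 ^ n ≤ (Finset.univ.filter (fun η : Finset T => PShat lo hi A η)).card := by
  induction n with
  | zero =>
    intro A _ hA
    simp only [pow_zero] at hA ⊢
    rw [Finset.one_le_card] at hA ⊢
    obtain ⟨f, hf⟩ := hA
    refine ⟨∅, ?_⟩
    simp only [Finset.mem_filter, Finset.mem_univ, true_and]
    intro τ hτ
    refine ⟨f, hf, by simp, ?_⟩
    intro x hx
    exact absurd (hτ hx) (by simp)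
  | succ n ih =>
    intro A hAQ hA
    have hPn : 1 ≤ P ^ n := Nat.one_le_pow _ _ (by omega)
    have hA2 : 2 ≤ A.card := by
      calc 2 ≤ P := hP
        _ ≤ P ^ n * P := Nat.le_mul_of_pos_left _ hPn
        _ = P ^ (n+1) := (pow_succ _ _).symm
        _ ≤ _ := hA
    obtain ⟨x, hlo, hhi⟩ := hs A hAQ hA2
    have h1 : P ^ n ≤ (A.filter (fun f => lo f x)).card := by
      have : P * P ^ n ≤ P * (A.filter (fun f => lo f x)).card := by
        rw [← pow_succ']; exact hA.trans hlo
      exact Nat.le_of_mul_le_mul_left this (by omega)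
    have h2 : P ^ n ≤ (A.filter (fun f => hi f x)).card := by
      have : P * P ^ n ≤ P * (A.filter (fun f => hi f x)).card := by
        rw [← pow_succ']; exact hA.trans hhi
      exact Nat.le_of_mul_le_mul_left this (by omega)
    have i1 := ih _ ((Finset.filter_subset _ _).trans hAQ) h1
    have i2 := ih _ ((Finset.filter_subset _ _).trans hAQ) h2
    set S1 := Finset.univ.filter (fun η : Finset T => PShat lo hi (A.filter (fun f => lo f x)) η) with hS1
    set S2 := Finset.univ.filter (fun η : Finset T => PShat lo hi (A.filter (fun f => hi f x)) η) with hS2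
    set S := Finset.univ.filter (fun η : Finset T => PShat lo hi A η) with hS
    have n1 : ∀ η ∈ S1, x ∉ η := by
      intro η hη hx
      simp only [hS1, Finset.mem_filter, Finset.mem_univ, true_and] at hη
      obtain ⟨f, hf, _, h⟩ := hη η (le_refl _)
      exact hex f x (Finset.mem_filter.1 hf).2 (h x hx)
    have n2 : ∀ η ∈ S2, x ∉ η := by
      intro η hη hx
      simp only [hS2, Finset.mem_filter, Finset.mem_univ, true_and] at hη
      obtain ⟨f, hf, h, _⟩ := hη ∅ (by simp)
      exact hex f x (h x hx (by simp)) (Finset.mem_filter.1 hf).2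
    have mono : ∀ B ⊆ A, ∀ η, PShat lo hi B η → PShat lo hi A η := by
      intro B hB η h τ hτ
      obtain ⟨f, hf, h'⟩ := h τ hτ
      exact ⟨f, hB hf, h'⟩
    have hsub : (S1 ∪ S2) ∪ (S1 ∩ S2).image (fun η => insert x η) ⊆ S := by
      intro η hη
      simp only [Finset.mem_union, Finset.mem_image] at hη
      simp only [hS, Finset.mem_filter, Finset.mem_univ, true_and]
      rcases hη with (h | h) | ⟨η', h, rfl⟩
      · exact mono _ (Finset.filter_subset _ _) _ (Finset.mem_filter.1 h).2
      · exact mono _ (Finset.filter_subset _ _) _ (Finset.mem_filter.1 h).2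
      · rw [Finset.mem_inter] at h
        have hx := n1 _ h.1
        have e1 := (Finset.mem_filter.1 h.1).2
        have e2 := (Finset.mem_filter.1 h.2).2
        intro τ hτ
        by_cases hxτ : x ∈ τ
        · obtain ⟨f, hf, ha, hb⟩ := e2 (τ.erase x) (by
            intro y hy
            have := hτ (Finset.mem_of_mem_erase hy)
            rcases Finset.mem_insert.1 this with h | h
            · exact absurd h (Finset.ne_of_mem_erase hy)
            · exact h)
          rw [Finset.mem_filter] at hf
          refine ⟨f, hf.1, ?_, ?_⟩
          · intro y hy hyτ
            rcases Finset.mem_insert.1 hy with h | h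
            · subst h; exact absurd hxτ hyτ
            · exact ha y h (fun h' => hyτ (Finset.mem_of_mem_erase h'))
          · intro y hy
            by_cases hyx : y = x
            · subst hyx; exact hf.2
            · exact hb y (Finset.mem_erase.2 ⟨hyx, hy⟩)
        · obtain ⟨f, hf, ha, hb⟩ := e1 τ (by
            intro y hy
            have := hτ hy
            rcases Finset.mem_insert.1 this with h | h
            · subst h; exact absurd hy hxτ
            · exact h)
          rw [Finset.mem_filter] at hf
          refine ⟨f, hf.1, ?_, hb⟩
          intro y hy hyτ
          rcases Finset.mem_insert.1 hy with h | h
          · subst h; exact hf.2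
          · exact ha y h hyτ
    have hdisj : Disjoint (S1 ∪ S2) ((S1 ∩ S2).image (fun η => insert x η)) := by
      rw [Finset.disjoint_left]
      intro η h1 h2
      obtain ⟨η', _, rfl⟩ := Finset.mem_image.1 h2
      rcases Finset.mem_union.1 h1 with h | h
      · exact n1 _ h (Finset.mem_insert_self _ _)
      · exact n2 _ h (Finset.mem_insert_self _ _)
    have hinj : ((S1 ∩ S2).image (fun η => insert x η)).card = (S1 ∩ S2).card := by
      apply Finset.card_image_of_injOn
      intro η h1 η' h2 h
      have a1 := n1 _ (Finset.mem_inter.1 (Finset.mem_coe.1 h1)).1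
      have a2 := n1 _ (Finset.mem_inter.1 (Finset.mem_coe.1 h2)).1
      have := congrArg (fun z => Finset.erase z x) h
      simpa [Finset.erase_insert a1, Finset.erase_insert a2] using this
    have hc := Finset.card_le_card hsub
    rw [Finset.card_union_of_disjoint hdisj, hinj, Finset.card_union_add_card_inter] at hc
    rw [pow_succ]; omega

lemma sum_pow_card {T : Type*} [Fintype T] (x : ℝ) :
    ∑ η : Finset T, x ^ η.card = (1 + x) ^ Fintype.card T := by
  classical
  have := Finset.prod_one_add (f := fun _ : T => x) (Finset.univ : Finset T)
  simp at this
  rw [this]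

open Classical in
lemma card_small {T : Type*} [Fintype T] (d : ℕ) (hd : 1 ≤ d) (hdT : d ≤ Fintype.card T)
    (𝒮 : Finset (Finset T)) (h𝒮 : ∀ η ∈ 𝒮, η.card ≤ d) :
    (𝒮.card : ℝ) ≤ (3 * (Fintype.card T / d : ℝ)) ^ d := by
  set M := Fintype.card T with hM
  have hd0 : (0:ℝ) < d := by exact_mod_cast hd
  have hM0 : (0:ℝ) < M := by exact_mod_cast (by omega : 0 < M)
  have hx0 : (0:ℝ) < d / M := by positivity
  have hx1 : (d / M : ℝ) ≤ 1 := by rw [div_le_one hM0]; exact_mod_cast hdT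
  have h1 : (𝒮.card : ℝ) * (d / M : ℝ) ^ d ≤ (1 + d / M : ℝ) ^ M := by
    rw [← sum_pow_card, ← nsmul_eq_mul, ← Finset.sum_const]
    calc _ ≤ ∑ η ∈ 𝒮, (d / M : ℝ) ^ η.card :=
          Finset.sum_le_sum fun η h => pow_le_pow_of_le_one hx0.le hx1 (h𝒮 η h)
      _ ≤ _ := Finset.sum_le_sum_of_subset_of_nonneg (Finset.subset_univ _)
          (fun _ _ _ => by positivity)
  have h2 : (1 + d / M : ℝ) ^ M ≤ 3 ^ d := by
    calc (1 + d / M : ℝ) ^ M ≤ (Real.exp (d / M)) ^ M := by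
          apply pow_le_pow_left₀ (by positivity)
          linarith [Real.add_one_le_exp (d / M : ℝ)]
      _ = Real.exp 1 ^ d := by
          rw [← Real.exp_nat_mul, ← Real.exp_nat_mul]; congr 1; field_simp
      _ ≤ _ := by
          apply pow_le_pow_left₀ (by positivity)
          linarith [Real.exp_one_lt_d9]
  have h3 : (M / d : ℝ) ^ d * (d / M : ℝ) ^ d = 1 := by
    rw [← mul_pow]; field_simp; simp
  have h4 : (0:ℝ) ≤ (M / d : ℝ) ^ d := by positivity
  calc (𝒮.card : ℝ) = 𝒮.card * ((M / d : ℝ) ^ d * (d / M : ℝ) ^ d) := by rw [h3, mul_one]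
    _ = (M / d : ℝ) ^ d * (𝒮.card * (d / M : ℝ) ^ d) := by ring
    _ ≤ (M / d : ℝ) ^ d * 3 ^ d := mul_le_mul_of_nonneg_left (h1.trans h2) h4
    _ = _ := by rw [mul_pow]; ring

open Classical in
lemma extraction {α Ω : Type*} (Q : Finset α) (S : Finset Ω) (w : Ω → ℝ) (hw : ∀ x, 0 ≤ w x)
    (hw1 : ∑ x ∈ S, w x = 1) (sep : α → α → Ω → Prop) (E : ℝ) (hE : 0 < E) (m : ℕ)
    (hsep : ∀ f ∈ Q, ∀ g ∈ Q, f ≠ g → 1 / E ≤ ∑ x ∈ S.filter (fun x => sep f g x), w x)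
    (hm : (Q.card : ℝ) ^ 2 ≤ Real.exp (m / (4 * E))) :
    ∃ y : Fin m → Ω, ∀ f ∈ Q, ∀ g ∈ Q, f ≠ g →
      (m / (4 * E) : ℝ) ≤ ((Finset.univ.filter (fun i => sep f g (y i))).card : ℝ) := by
  set W : (Fin m → Ω) → ℝ := fun y => ∏ i, w (y i) with hW
  set X : Finset (Fin m → Ω) := Fintype.piFinset (fun _ => S) with hX
  have hWsum : ∑ y ∈ X, W y = 1 := by
    have := Finset.prod_univ_sum (fun _ : Fin m => S) (fun _ x => w x)
    rw [hX, hW, ← this]; simp [hw1]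
  set ψ : α × α → Ω → ℝ := fun p x => if sep p.1 p.2 x then 1/2 else 1 with hψ
  set Φ : (Fin m → Ω) → ℝ := fun y => ∑ p ∈ Q.offDiag, ∏ i, ψ p (y i) with hΦ
  have hpair : ∀ p ∈ Q.offDiag, ∑ y ∈ X, W y * ∏ i, ψ p (y i) ≤ Real.exp (-(m / (2*E))) := by
    intro p hp
    rw [Finset.mem_offDiag] at hp
    have e1 : ∑ y ∈ X, W y * ∏ i, ψ p (y i) = (∑ x ∈ S, w x * ψ p x) ^ m := by
      have := Finset.prod_univ_sum (fun _ : Fin m => S) (fun _ x => w x * ψ p x)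
      simp only [Finset.prod_const, Finset.card_univ, Fintype.card_fin] at this
      rw [this]
      exact Finset.sum_congr rfl fun y _ => by rw [hW, ← Finset.prod_mul_distrib]
    have e2 : ∑ x ∈ S, w x * ψ p x ≤ 1 - 1 / (2 * E) := by
      have : ∑ x ∈ S, w x * ψ p x =
          ∑ x ∈ S, w x - (1/2) * ∑ x ∈ S.filter (fun x => sep p.1 p.2 x), w x := by
        rw [Finset.sum_filter, Finset.mul_sum, ← Finset.sum_sub_distrib]
        refine Finset.sum_congr rfl fun x _ => ?_
        simp only [hψ]; split_ifs <;> ring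
      rw [this, hw1]
      have := hsep p.1 hp.1 p.2 hp.2.1 hp.2.2
      have h3 : 1 / (2 * E) = (1/2) * (1 / E) := by field_simp
      rw [h3]; linarith
    have e0 : 0 ≤ ∑ x ∈ S, w x * ψ p x := Finset.sum_nonneg fun x _ =>
      mul_nonneg (hw x) (by simp only [hψ]; split_ifs <;> norm_num)
    rw [e1]
    calc _ ≤ (Real.exp (-(1 / (2*E)))) ^ m := by
          apply pow_le_pow_left₀ e0
          linarith [Real.add_one_le_exp (-(1 / (2*E)))]
      _ = _ := by rw [← Real.exp_nat_mul]; congr 1; field_simp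
  have htot : ∑ y ∈ X, W y * Φ y ≤ Real.exp (-(m / (4*E))) := by
    calc ∑ y ∈ X, W y * Φ y = ∑ p ∈ Q.offDiag, ∑ y ∈ X, W y * ∏ i, ψ p (y i) := by
          simp only [hΦ, Finset.mul_sum]; exact Finset.sum_comm
      _ ≤ ∑ p ∈ Q.offDiag, Real.exp (-(m / (2*E))) := Finset.sum_le_sum hpair
      _ = Q.offDiag.card * Real.exp (-(m / (2*E))) := by rw [Finset.sum_const, nsmul_eq_mul]
      _ ≤ Real.exp (m / (4 * E)) * Real.exp (-(m / (2*E))) := by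
          apply mul_le_mul_of_nonneg_right _ (Real.exp_pos _).le
          refine le_trans ?_ hm
          rw [Finset.offDiag_card]
          have : Q.card * Q.card - Q.card ≤ Q.card ^ 2 := by rw [sq]; omega
          exact_mod_cast this
      _ = _ := by rw [← Real.exp_add]; congr 1; field_simp; ring
  have hex : ∃ y ∈ X, Φ y ≤ Real.exp (-(m / (4*E))) := by
    by_contra! hcon
    have hpos : ∃ y ∈ X, 0 < W y := by
      by_contra! h
      have := Finset.sum_nonpos h
      rw [hWsum] at this; linarith
    obtain ⟨y0, hy0, hy0'⟩ := hpos
    have hWn : ∀ y, 0 ≤ W y := fun y => Finset.prod_nonneg fun i _ => hw _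
    have : ∑ y ∈ X, W y * Real.exp (-(m / (4*E))) < ∑ y ∈ X, W y * Φ y :=
      Finset.sum_lt_sum (fun y hy => mul_le_mul_of_nonneg_left (hcon y hy).le (hWn y))
        ⟨y0, hy0, mul_lt_mul_of_pos_left (hcon y0 hy0) hy0'⟩
    rw [← Finset.sum_mul, hWsum, one_mul] at this
    linarith
  obtain ⟨y, _, hy⟩ := hex
  refine ⟨y, fun f hf g hg hfg => ?_⟩
  have hψ0 : ∀ p x, 0 ≤ ψ p x := fun p x => by simp only [hψ]; split_ifs <;> norm_num
  have h1 : ∏ i, ψ (f, g) (y i) ≤ Φ y :=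
    Finset.single_le_sum (f := fun p => ∏ i, ψ p (y i))
      (fun p _ => Finset.prod_nonneg fun i _ => hψ0 _ _) (Finset.mem_offDiag.2 ⟨hf, hg, hfg⟩)
  have h2 : ∏ i, ψ (f, g) (y i) = (1/2 : ℝ) ^ (Finset.univ.filter (fun i => sep f g (y i))).card := by
    simp only [hψ, Finset.prod_ite, Finset.prod_const, one_pow, mul_one]
  have h3 : Real.exp (-((Finset.univ.filter (fun i => sep f g (y i))).card : ℝ)) ≤
      (1/2 : ℝ) ^ (Finset.univ.filter (fun i => sep f g (y i))).card := by
    have : Real.exp (-1) ≤ 1/2 := by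
      rw [Real.exp_neg, one_div]
      apply inv_anti₀ (by norm_num)
      linarith [Real.exp_one_gt_d9]
    calc _ = (Real.exp (-1)) ^ (Finset.univ.filter (fun i => sep f g (y i))).card := by
          rw [← Real.exp_nat_mul]; congr 1; ring
      _ ≤ _ := pow_le_pow_left₀ (Real.exp_pos _).le this _
  have h4 := h3.trans (h2 ▸ h1.trans hy)
  rw [Real.exp_le_exp] at h4
  linarith

lemma shatters_singleton {Ω : Type*} (F : Set (Ω → ℝ)) (r t : ℝ) (htr : t ≤ r) (f g : Ω → ℝ)
    (hf : f ∈ F) (hg : g ∈ F) (x : Ω) (h : r ≤ |f x - g x|) : Shatters F t {x} := by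
  wlog hle : g x ≤ f x generalizing f g
  · exact this g f hg hf (by rwa [abs_sub_comm]) (by linarith)
  rw [abs_of_nonneg (by linarith)] at h
  refine ⟨g, fun τ hτ => ?_⟩
  by_cases hx : x ∈ τ
  · refine ⟨f, hf, ?_, ?_⟩
    · intro y hy hy'
      rw [Finset.mem_singleton] at hy; subst hy; exact absurd hx hy'
    · intro y hy
      have := hτ hy
      rw [Finset.mem_singleton] at this; subst this; linarith
  · refine ⟨g, hg, fun _ _ _ => le_refl _, ?_⟩
    intro y hy
    have := hτ hy
    rw [Finset.mem_singleton] at this; subst this; exact absurd hy hx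

lemma exists_level_s1 (R r u v : ℝ) (hr : 0 < r) (L : ℕ) (hL : 4 * R / r + 2 ≤ L)
    (hu : |u| ≤ R) (_hv : |v| ≤ R) (huv : u + r ≤ v) :
    ∃ l : Fin L, u ≤ -R + (l : ℕ) * (r / 2) ∧ -R + (l : ℕ) * (r / 2) + r / 2 ≤ v := by
  have h0 : 0 ≤ (u + R) / (r / 2) := by
    apply div_nonneg <;> linarith [neg_le_of_abs_le hu]
  have h1 := Nat.le_ceil ((u + R) / (r / 2))
  have h2 := Nat.ceil_lt_add_one h0
  have h3 : (u + R) / (r / 2) ≤ 4 * R / r := by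
    rw [div_le_div_iff₀ (by linarith) hr]
    have := le_of_abs_le hu
    nlinarith
  have h4 : ⌈(u + R) / (r / 2)⌉₊ < L := by
    have : (⌈(u + R) / (r / 2)⌉₊ : ℝ) < L := by linarith
    exact_mod_cast this
  refine ⟨⟨_, h4⟩, ?_, ?_⟩
  · rw [div_le_iff₀ (by linarith)] at h1
    simp only; linarith
  · have : (⌈(u + R) / (r / 2)⌉₊ : ℝ) * (r/2) < ((u + R) / (r / 2) + 1) * (r/2) :=
      mul_lt_mul_of_pos_right h2 (by linarith)
    rw [add_mul, div_mul_cancel₀ _ (by linarith)] at this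
    simp only; linarith

open Classical in
lemma split_lemma {Ω : Type*} (A : Finset (Ω → ℝ)) (f0 : Ω → ℝ) (r R : ℝ) (hr : 0 < r)
    (E L P : ℕ) (hE : 1 ≤ E) (hL : 4 * R / r + 2 ≤ L) (hL1 : 1 ≤ L) (hP : 16 * E * L ≤ P)
    (m : ℕ) (hm : 1 ≤ m) (y : Fin m → Ω)
    (hy : ∀ f ∈ A, ∀ g ∈ A, f ≠ g → (m / (4 * E) : ℝ) ≤
      ((Finset.univ.filter (fun i => r ≤ |f (y i) - g (y i)| ∧ |f (y i) - f0 (y i)| ≤ R ∧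
        |g (y i) - f0 (y i)| ≤ R)).card : ℝ)) (hA : 2 ≤ A.card) :
    ∃ x : Fin m × Fin L,
      A.card ≤ P * (A.filter (fun f => f (y x.1) - f0 (y x.1) ≤ -R + (x.2 : ℕ) * (r / 2))).card ∧
      A.card ≤ P * (A.filter
        (fun f => -R + (x.2 : ℕ) * (r / 2) + r / 2 ≤ f (y x.1) - f0 (y x.1))).card := by
  set lo : (Ω → ℝ) → Fin m × Fin L → Prop :=
    fun f x => f (y x.1) - f0 (y x.1) ≤ -R + (x.2 : ℕ) * (r / 2) with hlo
  set hi : (Ω → ℝ) → Fin m × Fin L → Prop :=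
    fun f x => -R + (x.2 : ℕ) * (r / 2) + r / 2 ≤ f (y x.1) - f0 (y x.1) with hhi
  change ∃ x, A.card ≤ P * (A.filter (fun f => lo f x)).card ∧
    A.card ≤ P * (A.filter (fun f => hi f x)).card
  by_contra! hcon
  set N := A.card with hN
  have hprod : ∀ x, P * ((A.filter (fun f => lo f x)).card * (A.filter (fun f => hi f x)).card)
      ≤ N * (N - 1) := by
    intro x
    have c1 : (A.filter (fun f => lo f x)).card ≤ N := Finset.card_filter_le _ _
    have c2 : (A.filter (fun f => hi f x)).card ≤ N := Finset.card_filter_le _ _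
    by_cases h : N ≤ P * (A.filter (fun f => lo f x)).card
    · have := hcon x h
      calc _ = (A.filter (fun f => lo f x)).card * (P * (A.filter (fun f => hi f x)).card) := by ring
        _ ≤ N * (N - 1) := Nat.mul_le_mul c1 (by omega)
    · calc _ = (A.filter (fun f => hi f x)).card * (P * (A.filter (fun f => lo f x)).card) := by ring
        _ ≤ N * (N - 1) := Nat.mul_le_mul c2 (by omega)
  have hpair : ∀ p ∈ A.offDiag, (m / (4 * E) : ℝ) ≤
      ((Finset.univ.filter (fun x => lo p.1 x ∧ hi p.2 x)).card +
        (Finset.univ.filter (fun x => lo p.2 x ∧ hi p.1 x)).card : ℕ) := by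
    intro p hp
    rw [Finset.mem_offDiag] at hp
    refine (hy p.1 hp.1 p.2 hp.2.1 hp.2.2).trans ?_
    norm_cast
    refine le_trans ?_ (Finset.card_union_le _ _)
    refine le_trans (Finset.card_le_card ?_) (Finset.card_image_le (f := Prod.fst))
    intro i hi'
    simp only [Finset.mem_filter, Finset.mem_univ, true_and] at hi'
    obtain ⟨h1, h2, h3⟩ := hi'
    rw [Finset.mem_image]
    rcases le_total (p.1 (y i)) (p.2 (y i)) with h | h
    · rw [abs_sub_comm, abs_of_nonneg (by linarith)] at h1
      obtain ⟨l, hl1, hl2⟩ := exists_level_s1 R r _ _ hr L hL h2 h3 (by linarith)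
      exact ⟨(i, l), by simp [hlo, hhi]; left; constructor <;> linarith, rfl⟩
    · rw [abs_of_nonneg (by linarith)] at h1
      obtain ⟨l, hl1, hl2⟩ := exists_level_s1 R r _ _ hr L hL h3 h2 (by linarith)
      exact ⟨(i, l), by simp [hlo, hhi]; right; constructor <;> linarith, rfl⟩
  have hsum1 : ∑ p ∈ A.offDiag, (Finset.univ.filter (fun x => lo p.1 x ∧ hi p.2 x)).card ≤
      ∑ x, (A.filter (fun f => lo f x)).card * (A.filter (fun f => hi f x)).card := by
    calc _ ≤ ∑ p ∈ A ×ˢ A, (Finset.univ.filter (fun x => lo p.1 x ∧ hi p.2 x)).card :=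
          Finset.sum_le_sum_of_subset (by
            intro p hp; rw [Finset.mem_offDiag] at hp; exact Finset.mem_product.2 ⟨hp.1, hp.2.1⟩)
      _ = ∑ x, ∑ p ∈ A ×ˢ A, if lo p.1 x ∧ hi p.2 x then 1 else 0 := by
          simp only [Finset.card_filter]; exact Finset.sum_comm
      _ = _ := by
          refine Finset.sum_congr rfl fun x _ => ?_
          rw [← Finset.card_filter, ← Finset.card_product, ← Finset.filter_product]
  have hsum2 : ∑ p ∈ A.offDiag, (Finset.univ.filter (fun x => lo p.2 x ∧ hi p.1 x)).card ≤
      ∑ x, (A.filter (fun f => lo f x)).card * (A.filter (fun f => hi f x)).card := by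
    calc _ ≤ ∑ p ∈ A ×ˢ A, (Finset.univ.filter (fun x => lo p.2 x ∧ hi p.1 x)).card :=
          Finset.sum_le_sum_of_subset (by
            intro p hp; rw [Finset.mem_offDiag] at hp; exact Finset.mem_product.2 ⟨hp.1, hp.2.1⟩)
      _ = ∑ x, ∑ p ∈ A ×ˢ A, if hi p.1 x ∧ lo p.2 x then 1 else 0 := by
          simp only [Finset.card_filter, and_comm]; exact Finset.sum_comm
      _ = _ := by
          refine Finset.sum_congr rfl fun x _ => ?_
          rw [← Finset.card_filter, mul_comm (A.filter (fun f => lo f x)).card, ← Finset.card_product, ← Finset.filter_product]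
  have hsum3 : P * ∑ x, (A.filter (fun f => lo f x)).card * (A.filter (fun f => hi f x)).card ≤
      (m * L) * (N * (N - 1)) := by
    rw [Finset.mul_sum]
    refine (Finset.sum_le_sum fun x _ => hprod x).trans ?_
    simp
  have hoff : A.offDiag.card = N * (N - 1) := by
    rw [Finset.offDiag_card, Nat.mul_sub, mul_one]
  have hbig := Finset.sum_le_sum hpair
  rw [Finset.sum_const, nsmul_eq_mul, hoff, ← Nat.cast_sum, Finset.sum_add_distrib] at hbig
  set Z := ∑ x, (A.filter (fun f => lo f x)).card * (A.filter (fun f => hi f x)).card with hZ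
  have h5 : ((N * (N - 1) : ℕ) : ℝ) * (m / (4 * E)) ≤ 2 * Z := by
    refine hbig.trans ?_
    have : (∑ p ∈ A.offDiag, (Finset.univ.filter (fun x => lo p.1 x ∧ hi p.2 x)).card +
      ∑ p ∈ A.offDiag, (Finset.univ.filter (fun x => lo p.2 x ∧ hi p.1 x)).card) ≤ 2 * Z := by omega
    exact_mod_cast this
  have hE0 : (0:ℝ) < E := by exact_mod_cast hE
  have h6 : N * (N - 1) * m ≤ 8 * E * Z := by
    have : ((N * (N - 1) : ℕ) : ℝ) * m ≤ 8 * E * Z := by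
      rw [mul_div_assoc', div_le_iff₀ (by positivity)] at h5
      linarith
    exact_mod_cast this
  have hK : 0 < N * (N - 1) * m := by
    apply Nat.mul_pos (Nat.mul_pos (by omega) (by omega)) (by omega)
  have h7 : P * (N * (N - 1) * m) ≤ 8 * E * L * (N * (N - 1) * m) := by
    calc _ ≤ P * (8 * E * Z) := Nat.mul_le_mul_left _ h6
      _ = 8 * E * (P * Z) := by ring
      _ ≤ 8 * E * ((m * L) * (N * (N - 1))) := Nat.mul_le_mul_left _ hsum3
      _ = _ := by ring
  have h8 := Nat.le_of_mul_le_mul_right h7 hK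
  have h9 : 1 ≤ E * L := Nat.mul_pos hE hL1
  nlinarith

open Classical in
lemma pshat_card {Ω : Type*} (F : Set (Ω → ℝ)) (Q : Finset (Ω → ℝ)) (hQF : ∀ f ∈ Q, f ∈ F)
    (f0 : Ω → ℝ) (r : ℝ) (hr : 0 < r) {T : Type*} (y : T → Ω) (θ : T → ℝ) (d : ℕ)
    (hd : ∀ σ : Finset Ω, Shatters F r σ → σ.card ≤ d) (η : Finset T)
    (hη : PShat (fun (f : Ω → ℝ) x => f (y x) - f0 (y x) ≤ θ x)
      (fun f x => θ x + r ≤ f (y x) - f0 (y x)) Q η) : η.card ≤ d := by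
  have hinj : Set.InjOn y (η : Set T) := by
    intro x hx x' hx' hxx
    by_contra hne
    obtain ⟨f, _, h1, h2⟩ := hη {x} (by simpa using hx)
    obtain ⟨g, _, h3, h4⟩ := hη {x'} (by simpa using hx')
    have a1 := h1 x' hx' (by simpa using fun h => hne h.symm)
    have a2 := h2 x (by simp)
    have a3 := h3 x hx (by simpa using hne)
    have a4 := h4 x' (by simp)
    simp only [hxx] at a1 a2 a3 a4
    linarith
  rw [← Finset.card_image_of_injOn hinj]
  apply hd
  rcases η.eq_empty_or_nonempty with rfl | hne
  · obtain ⟨f, hf, _⟩ := hη ∅ (by simp)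
    refine ⟨0, fun τ hτ => ⟨f, hQF f hf, by simp, ?_⟩⟩
    intro x hx; exact absurd (hτ hx) (by simp)
  have : Nonempty T := ⟨hne.choose⟩
  refine ⟨fun x => f0 x + θ (Function.invFunOn y (η : Set T) x), fun τ hτ => ?_⟩
  obtain ⟨f, hf, h1, h2⟩ := hη (η.filter (fun x => y x ∈ τ)) (Finset.filter_subset _ _)
  have hinv : ∀ x ∈ η, Function.invFunOn y (η : Set T) (y x) = x := fun x hx =>
    hinj.leftInvOn_invFunOn hx
  refine ⟨f, hQF f hf, ?_, ?_⟩
  · intro z hz hzτ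
    obtain ⟨x, hx, rfl⟩ := Finset.mem_image.1 hz
    have := h1 x hx (by simp [hx, hzτ])
    simp only [hinv x hx]; linarith
  · intro z hz
    obtain ⟨x, hx, rfl⟩ := Finset.mem_image.1 (hτ hz)
    have := h2 x (by simp [hx, hz])
    simp only [hinv x hx]; linarith

open Classical in
lemma lemmaA {Ω : Type*} (F : Set (Ω → ℝ)) (Q : Finset (Ω → ℝ)) (hQF : ∀ f ∈ Q, f ∈ F)
    (S : Finset Ω) (w : Ω → ℝ) (hw : ∀ x, 0 ≤ w x) (hw1 : ∑ x ∈ S, w x = 1)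
    (f0 : Ω → ℝ) (r R : ℝ) (hr : 0 < r) (E L q : ℕ) (hE : 1 ≤ E) (hL : 4 * R / r + 2 ≤ L)
    (hL1 : 1 ≤ L) (hq : 16 * E * L ≤ 2 ^ q) (d : ℕ)
    (hd : ∀ σ : Finset Ω, Shatters F (r / 2) σ → σ.card ≤ d)
    (hsep : ∀ f ∈ Q, ∀ g ∈ Q, f ≠ g → (1 / E : ℝ) ≤
      ∑ x ∈ S.filter (fun x => r ≤ |f x - g x| ∧ |f x - f0 x| ≤ R ∧ |g x - f0 x| ≤ R), w x) :
    Q.card ≤ 2 ^ (4 * q ^ 2 * d) := by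
  by_contra! hcon
  have hE0 : (0:ℝ) < E := by exact_mod_cast hE
  have hEL : 1 ≤ E * L := Nat.mul_pos hE hL1
  have hq16 : 16 ≤ 2 ^ q := by nlinarith
  have hq1 : 1 ≤ q := by
    rcases Nat.eq_zero_or_pos q with h | h
    · subst h; norm_num at hq16
    · exact h
  have hd1 : 1 ≤ d := by
    have : 1 < Q.card := lt_of_le_of_lt (Nat.one_le_two_pow) hcon
    obtain ⟨f, hf, g, hg, hfg⟩ := Finset.one_lt_card.1 this
    have h1 := hsep f hf g hg hfg
    have h2 : (S.filter (fun x => r ≤ |f x - g x| ∧ |f x - f0 x| ≤ R ∧ |g x - f0 x| ≤ R)).Nonempty := by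
      by_contra h
      rw [Finset.not_nonempty_iff_eq_empty] at h
      rw [h, Finset.sum_empty] at h1
      have : (0:ℝ) < 1 / E := by positivity
      linarith
    obtain ⟨x, hx⟩ := h2
    have := hd _ (shatters_singleton F r (r/2) (by linarith) f g (hQF f hf) (hQF g hg) x
      (Finset.mem_filter.1 hx).2.1)
    simpa using this
  set n := 4 * q * d with hn
  have hn1 : 1 ≤ n := by rw [hn]; exact Nat.mul_pos (by omega) hd1
  have hqn : 4 * q ^ 2 * d = q * n := by rw [hn]; ring
  rw [hqn] at hcon
  obtain ⟨Q', hQ'Q, hQ'⟩ := Finset.exists_subset_card_eq hcon.le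
  set m := 8 * E * q * n with hm
  have hm1 : 1 ≤ m := Nat.mul_pos (Nat.mul_pos (by omega) hq1) hn1
  have hmE : (m / (4 * E) : ℝ) = ((2 * (q * n) : ℕ) : ℝ) := by
    rw [hm]; push_cast; field_simp; ring
  obtain ⟨y, hy⟩ := extraction Q' S w hw hw1
    (fun f g x => r ≤ |f x - g x| ∧ |f x - f0 x| ≤ R ∧ |g x - f0 x| ≤ R) E hE0 m
    (fun f hf g hg hfg => by convert hsep f (hQ'Q hf) g (hQ'Q hg) hfg) (by
      rw [hmE, hQ']
      push_cast
      rw [← pow_mul, mul_comm (q * n) 2]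
      calc (2:ℝ) ^ (2 * (q * n)) ≤ (Real.exp 1) ^ (2 * (q * n)) :=
            pow_le_pow_left₀ (by norm_num) (by linarith [Real.exp_one_gt_d9]) _
        _ = _ := by rw [← Real.exp_nat_mul]; push_cast; ring_nf)
  have hcount := pshat_count (T := Fin m × Fin L)
    (fun (f : Ω → ℝ) x => f (y x.1) - f0 (y x.1) ≤ -R + (x.2 : ℕ) * (r / 2))
    (fun f x => -R + (x.2 : ℕ) * (r / 2) + r / 2 ≤ f (y x.1) - f0 (y x.1))
    (fun f x h1 h2 => by linarith) (2 ^ q) (by omega) Q'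
    (fun A hA hA2 => split_lemma A f0 r R hr E L (2 ^ q) hE hL hL1 hq m hm1 y
      (fun f hf g hg hfg => by convert hy f (hA hf) g (hA hg) hfg) hA2) n Q' (le_refl _)
      (by rw [hQ', ← pow_mul])
  set 𝒮 := Finset.univ.filter (fun η : Finset (Fin m × Fin L) => PShat
    (fun (f : Ω → ℝ) x => f (y x.1) - f0 (y x.1) ≤ -R + (x.2 : ℕ) * (r / 2))
    (fun f x => -R + (x.2 : ℕ) * (r / 2) + r / 2 ≤ f (y x.1) - f0 (y x.1)) Q' η) with h𝒮
  have hcardT : Fintype.card (Fin m × Fin L) = m * L := by simp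
  have hmd : m * L = (32 * (E * L) * q ^ 2) * d := by rw [hm, hn]; ring
  have hsmall := card_small d hd1 (by
    rw [hcardT, hmd]
    exact Nat.le_mul_of_pos_left _ (by positivity)) 𝒮 (by
      intro η hη
      rw [h𝒮, Finset.mem_filter] at hη
      exact pshat_card F Q' (fun f hf => hQF f (hQ'Q hf)) f0 (r/2) (by linarith)
        (fun x : Fin m × Fin L => y x.1) (fun x => -R + (x.2 : ℕ) * (r / 2)) d hd η hη.2)
  have hd0 : (0:ℝ) < d := by exact_mod_cast hd1
  have hv : (3 * ((Fintype.card (Fin m × Fin L) : ℕ) / d : ℝ)) = ((3 * (32 * (E * L) * q ^ 2) : ℕ) : ℝ) := by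
    rw [hcardT, hmd]; push_cast; field_simp
  rw [hv] at hsmall
  have hsmall' : 𝒮.card ≤ (3 * (32 * (E * L) * q ^ 2)) ^ d := by exact_mod_cast hsmall
  have hlt : 3 * (32 * (E * L) * q ^ 2) < 2 ^ (4 * q) := by
    have hq2 : q < 2 ^ q := Nat.lt_two_pow_self
    have e : 2 ^ (4 * q) = 2 ^ q * (2 ^ q * (2 ^ q * 2 ^ q)) := by rw [← pow_add, ← pow_add, ← pow_add]; congr 1; ring
    rw [e]
    have hqq : q ^ 2 < 2 ^ q * 2 ^ q := by nlinarith
    calc 3 * (32 * (E * L) * q ^ 2) = 6 * ((16 * E * L) * q ^ 2) := by ring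
      _ ≤ 2 ^ q * (2 ^ q * q ^ 2) := Nat.mul_le_mul (by omega) (Nat.mul_le_mul_right _ hq)
      _ < _ := by
        have : 0 < 2 ^ q := by positivity
        exact Nat.mul_lt_mul_of_pos_left (Nat.mul_lt_mul_of_pos_left hqq this) this
  have hfin : (3 * (32 * (E * L) * q ^ 2)) ^ d < 2 ^ n := by
    rw [hn, pow_mul]
    exact Nat.pow_lt_pow_left hlt (by omega)
  omega

open Classical in
lemma exists_net {α : Type*} (close : α → α → Prop) (hrefl : ∀ f, close f f)
    (hsymm : ∀ f g, close f g → close g f) (A : Finset α) :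
    ∃ Z ⊆ A, (∀ f ∈ Z, ∀ g ∈ Z, f ≠ g → ¬ close f g) ∧ ∀ f ∈ A, ∃ z ∈ Z, close f z := by
  induction A using Finset.induction_on with
  | empty => exact ⟨∅, by simp, by simp, by simp⟩
  | insert a A ha ih =>
    obtain ⟨Z, hZA, h1, h2⟩ := ih
    by_cases h : ∃ z ∈ Z, close a z
    · refine ⟨Z, hZA.trans (Finset.subset_insert _ _), h1, ?_⟩
      intro f hf
      rcases Finset.mem_insert.1 hf with rfl | hf
      · exact h
      · exact h2 f hf
    · push Not at h
      refine ⟨insert a Z, Finset.insert_subset_insert _ hZA, ?_, ?_⟩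
      · intro f hf g hg hfg
        rcases Finset.mem_insert.1 hf with rfl | hf'
        · rcases Finset.mem_insert.1 hg with rfl | hg
          · exact absurd rfl hfg
          · exact h g hg
        · rcases Finset.mem_insert.1 hg with rfl | hg
          · exact fun hc => h f hf' (hsymm _ _ hc)
          · exact h1 f hf' g hg hfg
      · intro f hf
        rcases Finset.mem_insert.1 hf with rfl | hf
        · exact ⟨f, Finset.mem_insert_self _ _, hrefl f⟩
        · obtain ⟨z, hz, hc⟩ := h2 f hf
          exact ⟨z, Finset.mem_insert_of_mem hz, hc⟩

open Classical in
lemma net_card {α : Type*} (close : α → α → Prop) (A Z : Finset α) (B : ℕ)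
    (hcov : ∀ f ∈ A, ∃ z ∈ Z, close f z)
    (hB : ∀ z ∈ Z, (A.filter (fun f => close f z)).card ≤ B) : A.card ≤ Z.card * B := by
  refine le_trans (Finset.card_le_card ?_)
    (Finset.card_biUnion_le_card_mul Z (fun z => A.filter (fun f => close f z)) B hB)
  intro f hf
  obtain ⟨z, hz, hc⟩ := hcov f hf
  exact Finset.mem_biUnion.2 ⟨z, hz, Finset.mem_filter.2 ⟨hf, hc⟩⟩

noncomputable def tailW {Ω : Type*} (S : Finset Ω) (w : Ω → ℝ) (f g : Ω → ℝ) (u : ℝ) : ℝ :=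
  ∑ x ∈ S, if u ≤ |f x - g x| then w x else 0

lemma layer (s : ℕ → ℝ) (u : ℝ) (K : ℕ) (hs : ∀ k, 0 ≤ s k) (hu : |u| < s K) :
    u ^ 2 ≤ s 0 ^ 2 + ∑ j ∈ Finset.range K, s (j + 1) ^ 2 * (if s j ≤ |u| then 1 else 0) := by
  induction K with
  | zero =>
    simp only [Finset.range_zero, Finset.sum_empty, add_zero]
    exact sq_le_sq' (by linarith [neg_abs_le u]) (by linarith [le_abs_self u])
  | succ K ih =>
    rw [Finset.sum_range_succ]
    by_cases h : s K ≤ |u|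
    · rw [if_pos h, mul_one]
      have h1 : u ^ 2 ≤ s (K+1) ^ 2 :=
        sq_le_sq' (by linarith [neg_abs_le u]) (by linarith [le_abs_self u])
      have h2 : 0 ≤ ∑ j ∈ Finset.range K, s (j + 1) ^ 2 * (if s j ≤ |u| then (1:ℝ) else 0) :=
        Finset.sum_nonneg fun j _ => by positivity
      nlinarith [sq_nonneg (s 0)]
    · rw [if_neg h, mul_zero, add_zero]
      exact ih (not_le.1 h)

open Classical in
lemma chain {Ω : Type*} (F : Set (Ω → ℝ)) (Q : Finset (Ω → ℝ)) (hQF : ∀ f ∈ Q, f ∈ F)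
    (S : Finset Ω) (w : Ω → ℝ) (hw : ∀ x, 0 ≤ w x) (hw1 : ∑ x ∈ S, w x = 1)
    (a t : ℝ) (ha : 1 < a) (ht : 0 < t) (b L β : ℕ) (hb8 : 8 ≤ b) (hba : 2 * a ^ 2 ≤ b)
    (hL : 8 * a + 2 ≤ L) (hβ1 : b ≤ 2 ^ β) (hβ2 : 64 * L ≤ 2 ^ β) (d : ℕ → ℕ)
    (hd : ∀ k, ∀ σ : Finset Ω, Shatters F (a ^ k * (t / 16)) σ → σ.card ≤ d k)
    (hsep : ∀ f ∈ Q, ∀ g ∈ Q, f ≠ g → t ^ 2 ≤ ∑ x ∈ S, w x * (f x - g x) ^ 2)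
    (K : ℕ) (hK : ∀ f ∈ F, ∀ g ∈ F, ∀ x, |f x - g x| < a ^ K * (t / 4)) (k : ℕ) :
    ∀ A ⊆ Q, (∀ f ∈ A, ∀ g ∈ A, ∀ j, k ≤ j →
        tailW S w f g (a ^ j * (t / 4)) ≤ 1 / (b : ℝ) ^ (j + 1)) →
      A.card ≤ 2 ^ (∑ j ∈ Finset.range k, 4 * (β * (j + 2)) ^ 2 * d j) := by
  have ha0 : 0 < a := by linarith
  have hb0 : (0:ℝ) < b := by exact_mod_cast (by omega : 0 < b)
  have hb8' : (8:ℝ) ≤ b := by exact_mod_cast hb8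
  induction k with
  | zero =>
    intro A hA htail
    simp only [Finset.range_zero, Finset.sum_empty, pow_zero]
    by_contra! hc
    obtain ⟨f, hf, g, hg, hfg⟩ := Finset.one_lt_card.1 hc
    have h1 := hsep f (hA hf) g (hA hg) hfg
    have h2 : ∑ x ∈ S, w x * (f x - g x) ^ 2 ≤ (t/4)^2 +
        ∑ j ∈ Finset.range K, (a ^ (j+1) * (t/4)) ^ 2 * tailW S w f g (a ^ j * (t/4)) := by
      calc _ ≤ ∑ x ∈ S, w x * ((a ^ 0 * (t/4)) ^ 2 + ∑ j ∈ Finset.range K,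
            (a ^ (j+1) * (t/4)) ^ 2 * (if a ^ j * (t/4) ≤ |f x - g x| then 1 else 0)) := by
            refine Finset.sum_le_sum fun x _ => mul_le_mul_of_nonneg_left ?_ (hw x)
            exact layer (fun j => a ^ j * (t/4)) (f x - g x) K (fun j => by positivity)
              (hK f (hQF f (hA hf)) g (hQF g (hA hg)) x)
        _ = _ := by
            simp only [mul_add, Finset.sum_add_distrib, ← Finset.sum_mul, hw1, tailW]
            congr 1
            · simp
            · simp only [Finset.mul_sum]
              rw [Finset.sum_comm]
              refine Finset.sum_congr rfl fun j _ => Finset.sum_congr rfl fun x _ => ?_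
              split_ifs <;> ring
    have h3 : ∑ j ∈ Finset.range K, (a ^ (j+1) * (t/4)) ^ 2 * tailW S w f g (a ^ j * (t/4)) ≤
        ∑ j ∈ Finset.range K, (t/4)^2 * ((1/2 : ℝ) * (1/2) ^ j) := by
      refine Finset.sum_le_sum fun j _ => ?_
      have e1 := htail f hf g hg j (Nat.zero_le _)
      calc _ ≤ (a ^ (j+1) * (t/4)) ^ 2 * (1 / (b:ℝ) ^ (j+1)) :=
            mul_le_mul_of_nonneg_left e1 (sq_nonneg _)
        _ = (t/4)^2 * ((a ^ 2 / b) ^ (j+1)) := by rw [div_pow]; ring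
        _ ≤ (t/4)^2 * ((1/2 : ℝ) ^ (j+1)) := by
            apply mul_le_mul_of_nonneg_left _ (sq_nonneg _)
            apply pow_le_pow_left₀ (by positivity)
            rw [div_le_div_iff₀ hb0 (by norm_num)]; linarith
        _ = _ := by rw [pow_succ]; ring
    rw [← Finset.mul_sum, ← Finset.mul_sum] at h3
    have h4 : ∑ j ∈ Finset.range K, (1/2 : ℝ) ^ j ≤ 2 := sum_geometric_two_le K
    have h5 : 0 < t ^ 2 := by positivity
    have h6 : (t/4)^2 * ((1/2 : ℝ) * ∑ j ∈ Finset.range K, (1/2 : ℝ) ^ j) ≤ (t/4)^2 * 1 :=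
      mul_le_mul_of_nonneg_left (by linarith) (sq_nonneg _)
    nlinarith
  | succ k ih =>
    intro A hA htail
    set sk := a ^ k * (t/4) with hsk
    have hsk0 : 0 < sk := by positivity
    set ε := 1 / (b : ℝ) ^ (k + 1) with hε
    have hε0 : 0 < ε := by positivity
    obtain ⟨Z, hZA, hZ1, hZ2⟩ := exists_net
      (fun f g => tailW S w f g (sk / 2) ≤ ε / 2) (by
        intro f
        have : tailW S w f f (sk/2) = 0 := by
          apply Finset.sum_eq_zero
          intro x _
          rw [if_neg]; simp; exact hsk0
        rw [this]; positivity) (by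
        intro f g h
        have : tailW S w g f (sk/2) = tailW S w f g (sk/2) := by
          simp only [tailW, abs_sub_comm]
        rw [this]; exact h) A
    have hcells : ∀ z ∈ Z, (A.filter (fun f => tailW S w f z (sk / 2) ≤ ε / 2)).card ≤
        2 ^ (∑ j ∈ Finset.range k, 4 * (β * (j + 2)) ^ 2 * d j) := by
      intro z _
      apply ih _ ((Finset.filter_subset _ _).trans hA)
      intro f hf g hg j hj
      rw [Finset.mem_filter] at hf hg
      rcases Nat.eq_or_lt_of_le hj with rfl | hj
      · have : tailW S w f g sk ≤ tailW S w f z (sk/2) + tailW S w g z (sk/2) := by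
          simp only [tailW]
          rw [← Finset.sum_add_distrib]
          refine Finset.sum_le_sum fun x _ => ?_
          have := hw x
          have tri : |f x - g x| ≤ |f x - z x| + |g x - z x| := by
            rw [abs_sub_comm (g x)]; exact abs_sub_le _ _ _
          split_ifs <;> linarith
        change tailW S w f g sk ≤ ε
        linarith [hf.2, hg.2]
      · exact htail f hf.1 g hg.1 j hj
    have hZcard : Z.card ≤ 2 ^ (4 * (β * (k + 2)) ^ 2 * d k) := by
      rcases Z.eq_empty_or_nonempty with rfl | ⟨f0, hf0⟩
      · simp
      have hL1 : 1 ≤ L := by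
        have : (1:ℝ) ≤ L := by linarith
        exact_mod_cast this
      refine lemmaA F Z (fun f hf => hQF f (hA (hZA hf))) S w hw hw1 f0 (sk/2) (a * sk)
        (by linarith) (4 * b ^ (k+1)) L (β * (k+2)) (Nat.mul_pos (by norm_num)
          (Nat.pow_pos (by omega))) ?_ hL1 ?_ (d k) ?_ ?_
      · have : 4 * (a * sk) / (sk / 2) = 8 * a := by field_simp; ring
        rw [this]; exact hL
      · calc 16 * (4 * b ^ (k+1)) * L = (64 * L) * b ^ (k+1) := by ring
          _ ≤ 2 ^ β * (2 ^ β) ^ (k+1) := Nat.mul_le_mul hβ2 (Nat.pow_le_pow_left hβ1 _)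
          _ = _ := by rw [← pow_mul, ← pow_add]; congr 1; ring
      · intro σ hσ
        apply hd k σ
        have : sk / 2 / 2 = a ^ k * (t / 16) := by rw [hsk]; ring
        rwa [this] at hσ
      · intro f hf g hg hfg
        have h1 := hZ1 f hf g hg hfg
        rw [not_le] at h1
        have h2 := htail f (hZA hf) f0 (hZA hf0) (k+1) (le_refl _)
        have h3 := htail g (hZA hg) f0 (hZA hf0) (k+1) (le_refl _)
        have hs1 : a ^ (k+1) * (t/4) = a * sk := by rw [hsk, pow_succ]; ring
        rw [hs1] at h2 h3
        have hε1 : 1 / (b:ℝ) ^ (k+1+1) ≤ ε / 8 := by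
          rw [hε, div_div]
          apply one_div_le_one_div_of_le (by positivity)
          rw [pow_succ]
          exact mul_le_mul_of_nonneg_left hb8' (by positivity)
        have h4 : tailW S w f g (sk/2) ≤ ∑ x ∈ S.filter (fun x => sk/2 ≤ |f x - g x| ∧
            |f x - f0 x| ≤ a * sk ∧ |g x - f0 x| ≤ a * sk), w x + tailW S w f f0 (a * sk)
            + tailW S w g f0 (a * sk) := by
          simp only [tailW]
          rw [Finset.sum_filter, ← Finset.sum_add_distrib, ← Finset.sum_add_distrib]
          refine Finset.sum_le_sum fun x _ => ?_
          have hwx := hw x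
          by_cases c1 : sk / 2 ≤ |f x - g x|
          · by_cases c2 : a * sk ≤ |f x - f0 x|
            · rw [if_pos c1, if_pos c2]
              split_ifs <;> linarith
            · by_cases c3 : a * sk ≤ |g x - f0 x|
              · rw [if_pos c1, if_pos c3]
                split_ifs <;> linarith
              · rw [if_pos c1, if_pos ⟨c1, (not_le.1 c2).le, (not_le.1 c3).le⟩, if_neg c2, if_neg c3]
                linarith
          · rw [if_neg c1]
            split_ifs <;> linarith
        have h5 : (1 / ((4 * b ^ (k+1) : ℕ) : ℝ)) = ε / 4 := by
          rw [hε]; push_cast; field_simp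
        rw [h5]
        linarith
    calc A.card ≤ Z.card * _ := net_card _ A Z _ hZ2 hcells
      _ ≤ _ := Nat.mul_le_mul_right _ hZcard
      _ = _ := by rw [Finset.sum_range_succ, ← pow_add, add_comm]

lemma sum_bound (n : ℕ) : ∑ j ∈ Finset.range n, ((j:ℝ) + 2) ^ 2 / 2 ^ j ≤ 22 := by
  have : ∑ j ∈ Finset.range n, ((j:ℝ) + 2) ^ 2 / 2 ^ j =
      22 - (2 * ((n:ℝ) + 2) ^ 2 + 4 * (n + 2) + 6) / 2 ^ n := by
    induction n with
    | zero => norm_num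
    | succ n ih =>
      rw [Finset.sum_range_succ, ih]; push_cast; rw [pow_succ]; field_simp; ring
  rw [this]
  have : (0:ℝ) ≤ (2 * ((n:ℝ) + 2) ^ 2 + 4 * (n + 2) + 6) / 2 ^ n := by positivity
  linarith

lemma combDim_half {Ω : Type*} (F : Set (Ω → ℝ)) (a : ℝ) (ha : 1 < a)
    (h : ∀ t : ℝ, 0 < t → combDim F (a * t) ≤ combDim F t / 2) (t : ℝ) (ht : 0 < t)
    (hfin : combDim F t ≠ ⊤) (k : ℕ) :
    combDim F (a ^ k * t) ≠ ⊤ ∧ (combDim F (a ^ k * t)).toReal ≤ (combDim F t).toReal / 2 ^ k := by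
  induction k with
  | zero => simp [hfin]
  | succ k ih =>
    have h1 := h (a ^ k * t) (by positivity)
    have e : a * (a ^ k * t) = a ^ (k+1) * t := by rw [pow_succ]; ring
    rw [e] at h1
    have h2 : combDim F (a ^ k * t) / 2 ≠ ⊤ := ENNReal.div_ne_top ih.1 (by norm_num)
    refine ⟨ne_top_of_le_ne_top h2 h1, ?_⟩
    have h3 := ENNReal.toReal_mono h2 h1
    rw [ENNReal.toReal_div] at h3
    refine h3.trans ?_
    simp only [ENNReal.toReal_ofNat]
    rw [pow_succ, ← div_div]
    linarith [ih.2]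

lemma upper (a : ℝ) (ha : 1 < a) : ∃ C > (0 : ℝ), ∀ (Ω : Type) (F : Set (Ω → ℝ)),
      (∀ t : ℝ, 0 < t → combDim F (a * t) ≤ combDim F t / 2) →
      ∀ t : ℝ, 0 < t → KPentropy F t ≤ ENNReal.ofReal C * combDim F ((1/16) * t) := by
  classical
  obtain ⟨b0, hb0⟩ := exists_nat_ge (2 * a ^ 2)
  obtain ⟨L, hL⟩ := exists_nat_ge (8 * a + 2)
  set b := max 8 b0 with hb
  set β := b + 64 * L with hβ
  have hb8 : 8 ≤ b := le_max_left _ _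
  have hβ0 : (0:ℝ) < β := by exact_mod_cast (by omega : 0 < β)
  have hba : 2 * a ^ 2 ≤ b := hb0.trans (by exact_mod_cast le_max_right _ _)
  have hβp : β < 2 ^ β := Nat.lt_two_pow_self
  refine ⟨88 * (β:ℝ) ^ 2, by positivity, ?_⟩
  intro Ω F hreg t ht
  by_cases hfin : combDim F ((1/16) * t) = ⊤
  · rw [hfin, ENNReal.mul_top]
    · exact le_top
    · simp; positivity
  have hhalf := combDim_half F a ha hreg ((1/16) * t) (by positivity) hfin
  set D := (combDim F ((1/16) * t)).toReal with hD
  have hD0 : 0 ≤ D := ENNReal.toReal_nonneg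
  set d : ℕ → ℕ := fun k => ⌊(combDim F (a ^ k * ((1/16) * t))).toReal⌋₊ with hd
  have hdle : ∀ k, (d k : ℝ) ≤ D / 2 ^ k := fun k =>
    (Nat.floor_le ENNReal.toReal_nonneg).trans (hhalf k).2
  have hdS : ∀ k, ∀ σ : Finset Ω, Shatters F (a ^ k * (t / 16)) σ → σ.card ≤ d k := by
    intro k σ hσ
    have e : a ^ k * (t / 16) = a ^ k * ((1/16) * t) := by ring
    rw [e] at hσ
    apply Nat.le_floor
    have : ((σ.card : ℕ) : ℝ≥0∞) ≤ combDim F (a ^ k * ((1/16) * t)) :=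
      le_iSup₂_of_le σ hσ (le_refl _)
    have := ENNReal.toReal_mono (hhalf k).1 this
    simpa using this
  obtain ⟨K, hK⟩ := exists_nat_gt D
  have hdK : d K = 0 := by
    have h1 : (K:ℝ) < 2 ^ K := by exact_mod_cast Nat.lt_two_pow_self
    have h2 : D / 2 ^ K < 1 := by rw [div_lt_one (by positivity)]; linarith
    have h3 : (d K : ℝ) < 1 := lt_of_le_of_lt (hdle K) h2
    have : d K < 1 := by exact_mod_cast h3
    omega
  have hKF : ∀ f ∈ F, ∀ g ∈ F, ∀ x, |f x - g x| < a ^ K * (t / 4) := by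
    intro f hf g hg x
    by_contra! hc
    have hp : 0 < a ^ K * t := by positivity
    have := hdS K {x} (shatters_singleton F _ _ (by linarith) f g hf hg x hc)
    rw [hdK] at this
    simp at this
  refine iSup₂_le fun m hm => ?_
  obtain ⟨S, w, f, hw, hw1, hfF, hsep⟩ := hm
  have hinj : Function.Injective f := by
    intro i j hij
    by_contra hne
    have : ∀ i j, i < j → f i = f j → False := by
      intro i j hlt h
      have := hsep i j hlt
      simp [h] at this
      nlinarith
    rcases lt_or_gt_of_ne hne with h | h
    · exact this i j h hij
    · exact this j i h hij.symm
  set Q := Finset.univ.image f with hQ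
  have hQm : Q.card = m := by rw [hQ, Finset.card_image_of_injective _ hinj]; simp
  have hQF : ∀ g ∈ Q, g ∈ F := by
    intro g hg
    obtain ⟨i, _, rfl⟩ := Finset.mem_image.1 hg
    exact hfF i
  have hch := chain F Q hQF S w hw hw1 a t ha ht b L β hb8 hba hL (by omega) (by omega) d hdS
    (by
      intro g hg g' hg' hne
      obtain ⟨i, _, rfl⟩ := Finset.mem_image.1 hg
      obtain ⟨j, _, rfl⟩ := Finset.mem_image.1 hg'
      have hij : i ≠ j := fun h => hne (by rw [h])
      rcases lt_or_gt_of_ne hij with h | h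
      · exact hsep i j h
      · refine (hsep j i h).trans (le_of_eq ?_)
        exact Finset.sum_congr rfl fun x _ => by ring) K hKF K Q (le_refl _) (by
      intro g hg g' hg' j hj
      have : tailW S w g g' (a ^ j * (t/4)) = 0 := by
        apply Finset.sum_eq_zero
        intro x _
        rw [if_neg]
        rw [not_le]
        refine lt_of_lt_of_le (hKF g (hQF g hg) g' (hQF g' hg') x) ?_
        exact mul_le_mul_of_nonneg_right (pow_le_pow_right₀ ha.le hj) (by positivity)
      rw [this]; positivity)
  rw [hQm] at hch
  have hlog : Real.log m ≤ 88 * (β:ℝ) ^ 2 * D := by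
    rcases Nat.eq_zero_or_pos m with h0 | h0
    · subst h0; simp; positivity
    set e := ∑ j ∈ Finset.range K, 4 * (β * (j + 2)) ^ 2 * d j with he
    have h1 : Real.log m ≤ e := by
      calc Real.log m ≤ Real.log ((2:ℝ) ^ e) := by
            apply Real.log_le_log (by exact_mod_cast h0)
            exact_mod_cast hch
        _ = e * Real.log 2 := by rw [Real.log_pow]
        _ ≤ e * 1 := mul_le_mul_of_nonneg_left (by linarith [Real.log_two_lt_d9]) (Nat.cast_nonneg _)
        _ = e := mul_one _
    refine h1.trans ?_
    rw [he]
    push_cast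
    calc ∑ j ∈ Finset.range K, 4 * ((β:ℝ) * (j + 2)) ^ 2 * d j ≤
        ∑ j ∈ Finset.range K, (4 * (β:ℝ) ^ 2 * D) * (((j:ℝ) + 2) ^ 2 / 2 ^ j) := by
          refine Finset.sum_le_sum fun j _ => ?_
          calc _ ≤ 4 * ((β:ℝ) * (j + 2)) ^ 2 * (D / 2 ^ j) :=
                mul_le_mul_of_nonneg_left (hdle j) (by positivity)
            _ = _ := by ring
      _ = (4 * (β:ℝ) ^ 2 * D) * ∑ j ∈ Finset.range K, (((j:ℝ) + 2) ^ 2 / 2 ^ j) := by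
          rw [Finset.mul_sum]
      _ ≤ (4 * (β:ℝ) ^ 2 * D) * 22 := mul_le_mul_of_nonneg_left (sum_bound K) (by positivity)
      _ = _ := by ring
  calc ENNReal.ofReal (Real.log m) ≤ ENNReal.ofReal (88 * (β:ℝ) ^ 2 * D) :=
        ENNReal.ofReal_le_ofReal hlog
    _ = _ := by rw [ENNReal.ofReal_mul (by positivity), hD, ENNReal.ofReal_toReal hfin]

open scoped symmDiff in
open Classical in
lemma lower {Ω : Type*} (F : Set (Ω → ℝ)) (t : ℝ) (ht : 0 < t) :
    ENNReal.ofReal (1/16) * combDim F (2 * t) ≤ KPentropy F t := by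
  rw [combDim, ENNReal.mul_iSup]
  refine iSup_le fun σ => ?_
  rw [ENNReal.mul_iSup]
  refine iSup_le fun hσ => ?_
  rcases Nat.eq_zero_or_pos σ.card with h0 | hpos
  · simp [h0]
  set n := σ.card with hn
  obtain ⟨h, hsh⟩ := hσ
  choose! f hfF hf1 hf2 using hsh
  obtain ⟨Z, hZA, hZ1, hZ2⟩ := exists_net (fun τ τ' : Finset Ω => 4 * (τ ∆ τ').card < n)
    (by intro τ; simpa using hpos) (by intro τ τ' h; rwa [symmDiff_comm]) σ.powerset
  -- ball size
  set V := (σ.powerset.filter (fun τ => 4 * τ.card < n)).card with hV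
  have hballs : ∀ z ∈ Z, (σ.powerset.filter (fun τ => 4 * (τ ∆ z).card < n)).card ≤ V := by
    intro z hz
    have hzσ := Finset.mem_powerset.1 (hZA hz)
    apply Finset.card_le_card_of_injOn (fun τ => τ ∆ z)
    · intro τ hτ
      simp only [Finset.coe_filter, Finset.mem_powerset, Set.mem_ofPred_eq] at hτ ⊢
      refine ⟨?_, hτ.2⟩
      intro x hx
      rcases Finset.mem_symmDiff.1 hx with h | h
      · exact hτ.1 h.1
      · exact hzσ h.1
    · intro τ _ τ' _ h
      exact symmDiff_left_injective z h
  have hcov := net_card _ _ Z V hZ2 (fun z hz => by convert hballs z hz)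
  rw [Finset.card_powerset, ← hn] at hcov
  have hVb : (V:ℝ) ^ 4 ≤ (81/8 : ℝ) ^ n := by
    have h1 : ∑ τ ∈ σ.powerset, (1/2 : ℝ) ^ τ.card = (3/2) ^ n := by
      have := Finset.prod_one_add (f := fun _ : Ω => (1/2:ℝ)) σ
      simp only [Finset.prod_const] at this
      rw [← this]; norm_num [hn]
    have hroot : ∃ ρ : ℝ, 0 < ρ ∧ ρ ^ 4 = (1/2 : ℝ) ^ n :=
      ⟨((1/2 : ℝ) ^ n) ^ ((1:ℝ)/4), by positivity, by
        rw [← Real.rpow_natCast, ← Real.rpow_mul (by positivity)]; norm_num⟩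
    obtain ⟨ρ, hρ0, hρ⟩ := hroot
    have h2 : (V:ℝ) * ρ ≤ (3/2) ^ n := by
      rw [← h1, hV, ← nsmul_eq_mul, ← Finset.sum_const]
      refine le_trans (Finset.sum_le_sum ?_) (Finset.sum_le_sum_of_subset_of_nonneg
        (Finset.filter_subset _ _) (fun _ _ _ => by positivity))
      intro τ hτ
      have hc := (Finset.mem_filter.1 hτ).2
      refine le_of_pow_le_pow_left₀ (n := 4) (by norm_num) (by positivity) ?_
      rw [hρ, ← pow_mul]
      exact pow_le_pow_of_le_one (by norm_num) (by norm_num) (by omega)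
    have h3 : ((V:ℝ) * ρ) ^ 4 ≤ ((3/2) ^ n) ^ 4 := pow_le_pow_left₀ (by positivity) h2 4
    rw [mul_pow, hρ] at h3
    have h4 : (1/2 : ℝ) ^ n * 2 ^ n = 1 := by rw [← mul_pow]; norm_num
    calc (V:ℝ) ^ 4 = (V:ℝ) ^ 4 * (1/2 : ℝ) ^ n * 2 ^ n := by rw [mul_assoc, h4, mul_one]
      _ ≤ ((3/2) ^ n) ^ 4 * 2 ^ n := mul_le_mul_of_nonneg_right h3 (by positivity)
      _ = _ := by rw [← pow_mul, mul_comm n 4, pow_mul, ← mul_pow]; norm_num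
  have hZb : (128/81 : ℝ) ^ n ≤ (Z.card : ℝ) ^ 4 := by
    have h1 : ((2:ℝ) ^ n) ^ 4 ≤ ((Z.card : ℝ) * V) ^ 4 :=
      pow_le_pow_left₀ (by positivity) (by exact_mod_cast hcov) 4
    rw [mul_pow] at h1
    have h2 : ((2:ℝ) ^ n) ^ 4 ≤ (Z.card : ℝ) ^ 4 * (81/8 : ℝ) ^ n :=
      h1.trans (mul_le_mul_of_nonneg_left hVb (by positivity))
    have h3 : ((2:ℝ) ^ n) ^ 4 = (128/81 : ℝ) ^ n * (81/8 : ℝ) ^ n := by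
      rw [← pow_mul, mul_comm n 4, pow_mul, ← mul_pow]; norm_num
    rw [h3] at h2
    exact le_of_mul_le_mul_right h2 (by positivity)
  have hlog : (1/16 : ℝ) * n ≤ Real.log Z.card := by
    have h1 := Real.log_le_log (by positivity) hZb
    rw [Real.log_pow, Real.log_pow] at h1
    have h2 : (1/4 : ℝ) ≤ Real.log (128/81) := by
      have := Real.one_sub_inv_le_log_of_pos (show (0:ℝ) < 128/81 by norm_num)
      norm_num at this ⊢
      linarith
    have h3 : (n:ℝ) * (1/4) ≤ n * Real.log (128/81) := mul_le_mul_of_nonneg_left h2 (Nat.cast_nonneg _)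
    push_cast at h1
    linarith
  have hKP : KPSeparated F t Z.card := by
    have hn0 : (0:ℝ) < n := by exact_mod_cast hpos
    refine ⟨σ, fun _ => 1 / n, fun i => f (Z.equivFin.symm i).1, fun _ => by positivity, ?_, ?_, ?_⟩
    · rw [Finset.sum_const, nsmul_eq_mul, ← hn]; field_simp
    · intro i
      exact hfF _ (Finset.mem_powerset.1 (hZA (Z.equivFin.symm i).2))
    · intro i j hij
      set z := Z.equivFin.symm i with hz
      set z' := Z.equivFin.symm j with hz'
      have hne : z.1 ≠ z'.1 := by
        intro h
        have := Z.equivFin.symm.injective (Subtype.ext h)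
        exact absurd this hij.ne
      have hs := hZ1 z.1 z.2 z'.1 z'.2 hne
      rw [not_lt] at hs
      have hzσ := Finset.mem_powerset.1 (hZA z.2)
      have hzσ' := Finset.mem_powerset.1 (hZA z'.2)
      have hsub : z.1 ∆ z'.1 ⊆ σ := by
        intro x hx
        rcases Finset.mem_symmDiff.1 hx with h | h
        · exact hzσ h.1
        · exact hzσ' h.1
      have hpt : ∀ x ∈ z.1 ∆ z'.1, 1 / (n:ℝ) * (4 * t ^ 2) ≤ 1 / (n:ℝ) * (f z.1 x - f z'.1 x) ^ 2 := by
        intro x hx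
        apply mul_le_mul_of_nonneg_left _ (by positivity)
        rcases Finset.mem_symmDiff.1 hx with h | h
        · have a1 := hf2 z.1 hzσ x h.1
          have a2 := hf1 z'.1 hzσ' x (hsub hx) h.2
          nlinarith
        · have a1 := hf2 z'.1 hzσ' x h.1
          have a2 := hf1 z.1 hzσ x (hsub hx) h.2
          nlinarith
      have h1 : ∑ x ∈ z.1 ∆ z'.1, 1 / (n:ℝ) * (f z.1 x - f z'.1 x) ^ 2 ≤
          ∑ x ∈ σ, 1 / (n:ℝ) * (f z.1 x - f z'.1 x) ^ 2 :=
        Finset.sum_le_sum_of_subset_of_nonneg hsub (fun _ _ _ => by positivity)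
      refine le_trans ?_ h1
      refine le_trans ?_ (Finset.sum_le_sum hpt)
      rw [Finset.sum_const, nsmul_eq_mul]
      have hs' : (n:ℝ) ≤ 4 * ((z.1 ∆ z'.1).card : ℝ) := by exact_mod_cast hs
      have e : ((z.1 ∆ z'.1).card : ℝ) * (1 / (n:ℝ) * (4 * t ^ 2)) =
        (4 * ((z.1 ∆ z'.1).card : ℝ)) * t ^ 2 / n := by ring
      rw [e, le_div_iff₀ hn0, mul_comm]
      exact mul_le_mul_of_nonneg_right hs' (by positivity)
  refine le_trans ?_ (le_iSup₂_of_le Z.card hKP (le_refl _))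
  calc ENNReal.ofReal (1/16) * (n : ℝ≥0∞) = ENNReal.ofReal ((1/16) * n) := by
        rw [ENNReal.ofReal_mul (by norm_num), ENNReal.ofReal_natCast]
    _ ≤ _ := ENNReal.ofReal_le_ofReal hlog

/-- If `F` satisfies the minimal regularity assumption
(`v(F, a t) ≤ (1/2) v(F,t)` for all `t > 0`, for some `a > 1`), then
`c·v(F,2t) ≤ D(F,t) ≤ C·v(F,ct)` for all `t > 0`, with `c > 0` absolute and `C = C(a)`. -/
theorem entropy_equiv_dimension_of_minimal_regularity :
    ∃ c > (0 : ℝ), ∀ a : ℝ, 1 < a → ∃ C > (0 : ℝ), ∀ (Ω : Type) (F : Set (Ω → ℝ)),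
      (∀ t : ℝ, 0 < t → combDim F (a * t) ≤ combDim F t / 2) →
      ∀ t : ℝ, 0 < t →
        ENNReal.ofReal c * combDim F (2 * t) ≤ KPentropy F t ∧
        KPentropy F t ≤ ENNReal.ofReal C * combDim F (c * t) := by
  refine ⟨1/16, by norm_num, fun a ha => ?_⟩
  obtain ⟨C, hC, h⟩ := upper a ha
  exact ⟨C, hC, fun Ω F hreg t ht => ⟨lower F t ht, h Ω F hreg t ht⟩⟩
end
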